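/- arXiv:2412.12026 — 2 statements merged into one kernel-verified Lean document; each statement's English description precedes it below -/
import Mathlib

section
/- Let α,β>0, γ,δ≥0, 0≤q<1, define a,b,c,d via φ±, and assume ab<1. For N∈ℕ define a probability measure μ_N on {0,1}^N by μ_N(τ) := (1/Z_N^{(q,a,b,c,d)}) ∑_{λ∈TL_N : λ₁(j)−λ₁(j−1)=τ_j for all 1≤j≤N} wt_N^{(q,a,b,c,d)}(λ). Then μ_N is a stationary probability measure for the open ASEP generator on {0,1}^N with parameters α,β,γ,δ,q. Equivalently, under the two-layer measure P_N^{(q,a,b,c,d)} the first layer λ₁ has the same law as the height function (τ₁+⋯+τ_j)_{j=0,…,N} of the stationary measure of open ASEP. -/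
/-- `φ₊(x,y) = (1/(2x))(1-q-x+y + √((1-q-x+y)² + 4xy))`. -/
noncomputable def phiPlus (q x y : ℝ) : ℝ :=
  (1 / (2 * x)) * (1 - q - x + y + Real.sqrt ((1 - q - x + y) ^ 2 + 4 * x * y))

/-- `φ₋(x,y) = (1/(2x))(1-q-x+y - √((1-q-x+y)² + 4xy))`. -/
noncomputable def phiMinus (q x y : ℝ) : ℝ :=
  (1 / (2 * x)) * (1 - q - x + y - Real.sqrt ((1 - q - x + y) ^ 2 + 4 * x * y))

/-- Off-diagonal jump rates of the open ASEP on `{1,…,N}` with parameters `α,β,γ,δ,q`: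
bulk right jumps at rate `1`, bulk left jumps at rate `q`, entry/exit at the left boundary at
rates `α`/`γ`, and entry/exit at the right boundary at rates `δ`/`β`. -/
noncomputable def asepJump (N : ℕ) (α β γ δ q : ℝ) (τ τ' : Fin N → Bool) : ℝ :=
  (∑ i : Fin N, ∑ j : Fin N,
    if (j : ℕ) = (i : ℕ) + 1 ∧ τ i = true ∧ τ j = false ∧
        τ' = Function.update (Function.update τ i false) j true then (1 : ℝ) else 0) +
  q * (∑ i : Fin N, ∑ j : Fin N,
    if (j : ℕ) = (i : ℕ) + 1 ∧ τ i = false ∧ τ j = true ∧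
        τ' = Function.update (Function.update τ i true) j false then (1 : ℝ) else 0) +
  α * (∑ i : Fin N,
    if (i : ℕ) = 0 ∧ τ i = false ∧ τ' = Function.update τ i true then (1 : ℝ) else 0) +
  γ * (∑ i : Fin N,
    if (i : ℕ) = 0 ∧ τ i = true ∧ τ' = Function.update τ i false then (1 : ℝ) else 0) +
  δ * (∑ i : Fin N,
    if (i : ℕ) = N - 1 ∧ τ i = false ∧ τ' = Function.update τ i true then (1 : ℝ) else 0) +
  β * (∑ i : Fin N,
    if (i : ℕ) = N - 1 ∧ τ i = true ∧ τ' = Function.update τ i false then (1 : ℝ) else 0)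

/-- The generator matrix `Q` of the open ASEP on `{0,1}^N`. -/
noncomputable def asepGen (N : ℕ) (α β γ δ q : ℝ) (τ τ' : Fin N → Bool) : ℝ :=
  if τ' = τ then -∑ σ ∈ Finset.univ.filter (fun σ => σ ≠ τ), asepJump N α β γ δ q τ σ
  else asepJump N α β γ δ q τ τ'

/-- `μ` is a stationary measure for the open ASEP generator: `∑_τ μ(τ) Q(τ,τ') = 0` for all
`τ'`. -/
noncomputable def IsStationaryASEP (N : ℕ) (α β γ δ q : ℝ) (μ : (Fin N → Bool) → ℝ) : Prop :=
  ∀ τ' : Fin N → Bool, ∑ τ : Fin N → Bool, μ τ * asepGen N α β γ δ q τ τ' = 0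

/-- A Bernoulli path on `{0,…,N}`: increments in `{0,1}`. -/
def IsBPath (N : ℕ) (L : Fin (N+1) → ℤ) : Prop :=
  ∀ j : Fin N, L j.succ = L j.castSucc ∨ L j.succ = L j.castSucc + 1

/-- The two-layer configuration space `TL_N`. -/
def TLset (N : ℕ) : Set ((Fin (N+1) → ℤ) × (Fin (N+1) → ℤ)) :=
  {p | p.1 0 = 0 ∧ (∀ j, p.2 j ≤ p.1 j) ∧ IsBPath N p.1 ∧ IsBPath N p.2}

/-- The finite q-Pochhammer symbol `(z;q)_n = ∏_{j=0}^{n-1} (1 - z qʲ)`. -/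
noncomputable def qPoch (z q : ℝ) (n : ℕ) : ℝ := ∏ j ∈ Finset.range n, (1 - z * q ^ j)

/-- The local weight `W^{(q,c,d)}(x | u,v)`. -/
noncomputable def Wfac (q c d : ℝ) (x u v : ℤ) : ℝ :=
  if u = 1 ∧ v = 0 then 1 - q ^ x.toNat
  else if u = 1 ∧ v = 1 then 1 + d * q ^ x.toNat
  else if u = 0 ∧ v = 0 then 1 + c * q ^ x.toNat
  else 1 - c * d * q ^ x.toNat

/-- The two-layer weight `wt_N^{(q,a,b,c,d)}`. -/
noncomputable def twt (N : ℕ) (q a b c d : ℝ) (p : (Fin (N+1) → ℤ) × (Fin (N+1) → ℤ)) : ℝ :=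
  a ^ (p.1 0 - p.2 0).toNat * b ^ (p.1 (Fin.last N) - p.2 (Fin.last N)).toNat *
    (qPoch (c * d) q (p.1 (Fin.last N) - p.2 (Fin.last N)).toNat /
      qPoch q q (p.1 (Fin.last N) - p.2 (Fin.last N)).toNat) *
    ∏ j : Fin N, Wfac q c d (p.1 j.succ - p.2 j.succ)
      (p.1 j.succ - p.1 j.castSucc) (p.2 j.succ - p.2 j.castSucc)


section MatrixAnsatz

variable {K : Type*} [AddCommGroup K] [Module ℝ K]

/-- The product `M τ₁ ⋯ M τ_N` of operators along a word `τ`. -/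
noncomputable def wordOp (M : Bool → Module.End ℝ K) {N : ℕ} (τ : Fin N → Bool) :
    Module.End ℝ K :=
  (List.ofFn fun i => M (τ i)).prod

/-- The product of the operators strictly to the left of site `i`. -/
noncomputable def leftOp (M : Bool → Module.End ℝ K) {N : ℕ} (τ : Fin N → Bool) (i : Fin N) :
    Module.End ℝ K :=
  ((List.ofFn fun i => M (τ i)).take i).prod

/-- The product of the operators strictly to the right of site `i`. -/
noncomputable def rightOp (M : Bool → Module.End ℝ K) {N : ℕ} (τ : Fin N → Bool) (i : Fin N) :
    Module.End ℝ K :=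
  ((List.ofFn fun i => M (τ i)).drop (i + 1)).prod

variable (M : Bool → Module.End ℝ K) {N : ℕ}

theorem wordOp_succ (τ : Fin (N + 1) → Bool) :
    wordOp M τ = M (τ 0) * wordOp M (Fin.tail τ) := by
  simp [wordOp, List.ofFn_succ, Fin.tail]

theorem ofFn_update (τ : Fin N → Bool) (i : Fin N) (b : Bool) :
    (List.ofFn fun k => M (Function.update τ i b k)) =
      (List.ofFn fun k => M (τ k)).set i (M b) := by
  apply List.ext_getElem (by simp)
  intro n h₁ h₂
  simp only [List.getElem_ofFn, List.getElem_set, Function.update_apply, Fin.ext_iff]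
  by_cases h : n = i
  · rw [if_pos h, if_pos h.symm]
  · rw [if_neg h, if_neg (Ne.symm h)]

theorem wordOp_update (τ : Fin N → Bool) (i : Fin N) (b : Bool) :
    wordOp M (Function.update τ i b) = leftOp M τ i * M b * rightOp M τ i := by
  simp [wordOp, leftOp, rightOp, ofFn_update, List.prod_set]

theorem wordOp_eq (τ : Fin N → Bool) (i : Fin N) :
    wordOp M τ = leftOp M τ i * M (τ i) * rightOp M τ i := by
  simpa using wordOp_update M τ i (τ i)

theorem leftOp_of_val_eq_add_one (τ : Fin N → Bool) {i j : Fin N} (h : (j : ℕ) = i + 1) :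
    leftOp M τ j = leftOp M τ i * M (τ i) := by
  rw [leftOp, leftOp, h, List.prod_take_succ _ _ (by simp)]
  simp

theorem rightOp_of_val_eq_add_one (τ : Fin N → Bool) {i j : Fin N} (h : (j : ℕ) = i + 1) :
    rightOp M τ i = M (τ j) * rightOp M τ j := by
  rw [rightOp, rightOp, List.drop_eq_getElem_cons (by simp; omega), List.prod_cons]
  simp [← h]

theorem leftOp_update (τ : Fin N → Bool) (i : Fin N) (b : Bool) :
    leftOp M (Function.update τ i b) i = leftOp M τ i := by
  rw [leftOp, leftOp, ofFn_update, List.take_set, List.set_eq_of_length_le (by simp)]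

theorem rightOp_update {i j : Fin N} (h : (i : ℕ) < j + 1) (τ : Fin N → Bool) (b : Bool) :
    rightOp M (Function.update τ i b) j = rightOp M τ j := by
  simp [rightOp, ofFn_update, List.drop_set, h]

theorem wordOp_update_update {i j : Fin N} (h : (j : ℕ) = i + 1) (τ : Fin N → Bool)
    (b b' : Bool) :
    wordOp M (Function.update (Function.update τ i b) j b') =
      leftOp M τ i * M b * M b' * rightOp M τ j := by
  rw [wordOp_update, leftOp_of_val_eq_add_one M _ h, leftOp_update,
    rightOp_update M (by omega)]
  simp

theorem wordOp_eq_of_val_eq_add_one {i j : Fin N} (h : (j : ℕ) = i + 1) (τ : Fin N → Bool) :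
    wordOp M τ = leftOp M τ i * M (τ i) * M (τ j) * rightOp M τ j := by
  rw [wordOp_eq M τ j, leftOp_of_val_eq_add_one M τ h]

end MatrixAnsatz

theorem sum_fin_telescope {N : ℕ} (r : Fin N → ℝ) :
    (∑ i : Fin N, ∑ j : Fin N, if (j : ℕ) = (i : ℕ) + 1 then r j - r i else 0) +
      (∑ i : Fin N, if (i : ℕ) = 0 then r i else 0) -
      (∑ i : Fin N, if (i : ℕ) = N - 1 then r i else 0) = 0 := by
  cases N with
  | zero => simp
  | succ n =>
    have h₁ : (∑ i : Fin (n + 1), ∑ j : Fin (n + 1),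
        if (j : ℕ) = (i : ℕ) + 1 then r j - r i else 0) =
        ∑ i : Fin n, (r i.succ - r i.castSucc) := by
      rw [Fin.sum_univ_castSucc]
      have : ∀ j : Fin (n + 1), ¬ ((j : ℕ) = n + 1) := fun j => by omega
      simp only [Fin.val_castSucc, Fin.val_last, this, if_false, Finset.sum_const_zero, add_zero]
      refine Finset.sum_congr rfl fun i _ => ?_
      rw [Finset.sum_eq_single i.succ]
      · simp
      · intro j _ hj
        rw [if_neg]
        simpa [Fin.ext_iff] using hj
      · simp
    have h₂ : (∑ i : Fin (n + 1), if (i : ℕ) = 0 then r i else 0) = r 0 := by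
      rw [Finset.sum_eq_single 0] <;> simp +contextual
    have h₃ : (∑ i : Fin (n + 1), if (i : ℕ) = n + 1 - 1 then r i else 0) = r (Fin.last n) := by
      rw [Finset.sum_eq_single (Fin.last n)] <;> simp +contextual [Fin.ext_iff]
    rw [h₁, h₂, h₃, Finset.sum_sub_distrib]
    have := Fin.sum_univ_succ r
    have := Fin.sum_univ_castSucc r
    linarith

theorem asepJump_self (N : ℕ) (α β γ δ q : ℝ) (τ : Fin N → Bool) :
    asepJump N α β γ δ q τ τ = 0 := by
  have h₁ : ∀ (P : Prop) (i : Fin N) (b b' : Bool), b ≠ b' →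
      ¬ (P ∧ τ i = b ∧ τ = Function.update τ i b') := by
    rintro P i b b' hb ⟨-, rfl, h⟩
    apply hb
    conv_lhs => rw [h]
    simp
  have h₂ : ∀ (P : Prop) (i j : Fin N) (b b' c c' : Bool), b' ≠ c' →
      ¬ (P ∧ τ i = b ∧ τ j = b' ∧ τ = Function.update (Function.update τ i c) j c') := by
    rintro P i j b b' c c' hb ⟨-, -, rfl, h⟩
    apply hb
    conv_lhs => rw [h]
    simp
  unfold asepJump
  simp only [h₁ _ _ true false (by simp), h₁ _ _ false true (by simp),
    h₂ _ _ _ true false false true (by simp), h₂ _ _ _ false true true false (by simp), if_false,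
    Finset.sum_const_zero, mul_zero, add_zero]

theorem sum_mul_asepGen {N : ℕ} (α β γ δ q : ℝ) (μ : (Fin N → Bool) → ℝ) (τ' : Fin N → Bool) :
    ∑ τ, μ τ * asepGen N α β γ δ q τ τ' =
      ∑ τ, μ τ * asepJump N α β γ δ q τ τ' - μ τ' * ∑ σ, asepJump N α β γ δ q τ' σ := by
  have h : ∀ τ, asepGen N α β γ δ q τ τ' =
      asepJump N α β γ δ q τ τ' - if τ = τ' then ∑ σ, asepJump N α β γ δ q τ' σ else 0 := by
    intro τ
    unfold asepGen
    by_cases hτ : τ' = τ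
    · subst hτ
      rw [if_pos rfl, if_pos rfl, asepJump_self, Finset.sum_filter, zero_sub]
      congr 1
      refine Finset.sum_congr rfl fun σ _ => ?_
      split_ifs with hσ
      · rfl
      · rw [not_not.mp hσ, asepJump_self]
    · rw [if_neg hτ, if_neg (Ne.symm hτ), sub_zero]
  simp [h, mul_sub]

theorem sum_mul_site_jump {N : ℕ} (μ : (Fin N → Bool) → ℝ) (P : Fin N → Prop)
    [DecidablePred P] (b : Bool) (τ' : Fin N → Bool) :
    ∑ τ, μ τ * (∑ i, if P i ∧ τ i = b ∧ τ' = Function.update τ i !b then (1 : ℝ) else 0) =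
      ∑ i, if P i then (if τ' i = !b then μ (Function.update τ' i b) else 0) else 0 := by
  simp_rw [Finset.mul_sum]
  rw [Finset.sum_comm]
  refine Finset.sum_congr rfl fun i _ => ?_
  rw [Finset.sum_eq_single (Function.update τ' i b)]
  · by_cases hP : P i <;> by_cases hb : τ' i = !b <;> simp [hP, hb]
  · intro τ _ hτ
    rw [if_neg, mul_zero]
    rintro ⟨-, rfl, rfl⟩
    simp at hτ
  · simp

theorem sum_mul_bond_jump {N : ℕ} (μ : (Fin N → Bool) → ℝ) (b b' : Bool) (τ' : Fin N → Bool) :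
    ∑ τ, μ τ * (∑ i : Fin N, ∑ j : Fin N, if (j : ℕ) = (i : ℕ) + 1 ∧ τ i = b ∧ τ j = b' ∧
        τ' = Function.update (Function.update τ i !b) j !b' then (1 : ℝ) else 0) =
      ∑ i : Fin N, ∑ j : Fin N, if (j : ℕ) = (i : ℕ) + 1 then
        (if τ' i = (!b) ∧ τ' j = !b' then
          μ (Function.update (Function.update τ' i b) j b') else 0) else 0 := by
  simp_rw [Finset.mul_sum]
  rw [Finset.sum_comm]
  refine Finset.sum_congr rfl fun i _ => ?_
  rw [Finset.sum_comm]
  refine Finset.sum_congr rfl fun j _ => ?_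
  by_cases hP : (j : ℕ) = (i : ℕ) + 1
  swap
  · simp [hP]
  have hij : i ≠ j := by
    rintro rfl
    omega
  rw [if_pos hP, Finset.sum_eq_single (Function.update (Function.update τ' i b) j b')]
  · by_cases hb : τ' i = (!b) ∧ τ' j = !b'
    · rw [if_pos hb, if_pos, mul_one]
      refine ⟨hP, by simp [hij], by simp, ?_⟩
      rw [Function.update_comm hij, Function.update_idem, Function.update_comm hij.symm,
        Function.update_idem, ← hb.1, ← hb.2]
      simp
    · rw [if_neg hb, if_neg, mul_zero]
      rintro ⟨-, -, -, h⟩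
      apply hb
      rw [h]; simp [hij]
  · intro τ _ hτ
    rw [if_neg, mul_zero]
    rintro ⟨-, rfl, rfl, rfl⟩
    apply hτ
    rw [Function.update_comm hij, Function.update_idem, Function.update_comm hij.symm,
      Function.update_idem]
    simp
  · simp

theorem sum_mul_asepJump {N : ℕ} (α β γ δ q : ℝ) (μ : (Fin N → Bool) → ℝ)
    (τ : Fin N → Bool) :
    ∑ σ, μ σ * asepJump N α β γ δ q σ τ =
      (∑ i : Fin N, ∑ j : Fin N, if (j : ℕ) = (i : ℕ) + 1 then
        (if τ i = false ∧ τ j = true then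
          μ (Function.update (Function.update τ i true) j false) else 0) +
        q * (if τ i = true ∧ τ j = false then
          μ (Function.update (Function.update τ i false) j true) else 0) else 0) +
      (∑ i : Fin N, if (i : ℕ) = 0 then
        α * (if τ i = true then μ (Function.update τ i false) else 0) +
        γ * (if τ i = false then μ (Function.update τ i true) else 0) else 0) +
      (∑ i : Fin N, if (i : ℕ) = N - 1 then
        δ * (if τ i = true then μ (Function.update τ i false) else 0) +
        β * (if τ i = false then μ (Function.update τ i true) else 0) else 0) := by
  have h₁ := sum_mul_bond_jump μ true false τ
  have h₂ := sum_mul_bond_jump μ false true τ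
  have h₃ := fun b => sum_mul_site_jump μ (fun i : Fin N => (i : ℕ) = 0) b τ
  have h₄ := fun b => sum_mul_site_jump μ (fun i : Fin N => (i : ℕ) = N - 1) b τ
  have h₃t := h₃ true
  have h₃f := h₃ false
  have h₄t := h₄ true
  have h₄f := h₄ false
  simp only [Bool.not_true, Bool.not_false] at h₁ h₂ h₃t h₃f h₄t h₄f
  unfold asepJump
  simp only [mul_add, Finset.sum_add_distrib, mul_left_comm (μ _), ← Finset.mul_sum, h₁, h₂, h₃t,
    h₃f, h₄t, h₄f]
  have e : ∀ (p : Prop) [Decidable p] (x y : ℝ), (if p then x + y else 0) =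
      (if p then x else 0) + if p then y else 0 := by
    intro p _ x y; split_ifs <;> simp
  have e' : ∀ (p : Prop) [Decidable p] (x y : ℝ), (if p then x * y else 0) =
      x * if p then y else 0 := by
    intro p _ x y; split_ifs <;> simp
  simp only [e, e', Finset.sum_add_distrib, ← Finset.mul_sum]
  ring

theorem sum_asepJump {N : ℕ} (α β γ δ q : ℝ) (τ : Fin N → Bool) :
    ∑ σ, asepJump N α β γ δ q τ σ =
      (∑ i : Fin N, ∑ j : Fin N, if (j : ℕ) = (i : ℕ) + 1 then
        (if τ i = true ∧ τ j = false then 1 else 0) +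
        q * (if τ i = false ∧ τ j = true then 1 else 0) else 0) +
      (∑ i : Fin N, if (i : ℕ) = 0 then
        α * (if τ i = false then 1 else 0) + γ * (if τ i = true then 1 else 0) else 0) +
      (∑ i : Fin N, if (i : ℕ) = N - 1 then
        δ * (if τ i = false then 1 else 0) + β * (if τ i = true then 1 else 0) else 0) := by
  have h₁ : ∀ (P : Fin N → Prop) [DecidablePred P] (b b' : Bool),
      ∑ σ : Fin N → Bool, ∑ i : Fin N,
        (if P i ∧ τ i = b ∧ σ = Function.update τ i b' then (1 : ℝ) else 0) =
      ∑ i : Fin N, if P i then (if τ i = b then 1 else 0) else 0 := by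
    intro P _ b b'
    rw [Finset.sum_comm]
    refine Finset.sum_congr rfl fun i _ => ?_
    by_cases hP : P i <;> by_cases hb : τ i = b <;> simp [hP, hb]
  have h₂ : ∀ (b b' c c' : Bool), ∑ σ : Fin N → Bool, ∑ i : Fin N, ∑ j : Fin N,
        (if (j : ℕ) = (i : ℕ) + 1 ∧ τ i = b ∧ τ j = b' ∧
          σ = Function.update (Function.update τ i c) j c' then (1 : ℝ) else 0) =
      ∑ i : Fin N, ∑ j : Fin N, if (j : ℕ) = (i : ℕ) + 1 then
        (if τ i = b ∧ τ j = b' then 1 else 0) else 0 := by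
    intro b b' c c'
    rw [Finset.sum_comm]
    refine Finset.sum_congr rfl fun i _ => ?_
    rw [Finset.sum_comm]
    refine Finset.sum_congr rfl fun j _ => ?_
    by_cases hP : (j : ℕ) = (i : ℕ) + 1 <;> by_cases hb : τ i = b <;>
      by_cases hb' : τ j = b' <;> simp [hP, hb, hb']
  unfold asepJump
  simp only [Finset.sum_add_distrib, ← Finset.mul_sum, h₁, h₂]
  have e : ∀ (p : Prop) [Decidable p] (x y : ℝ), (if p then x + y else 0) =
      (if p then x else 0) + if p then y else 0 := by
    intro p _ x y; split_ifs <;> simp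
  have e' : ∀ (p : Prop) [Decidable p] (x y : ℝ), (if p then x * y else 0) =
      x * if p then y else 0 := by
    intro p _ x y; split_ifs <;> simp
  simp only [e, e', Finset.sum_add_distrib, ← Finset.mul_sum]
  ring

/-- The Derrida–Evans–Hakim–Pasquier matrix product ansatz: a quadratic algebra with boundary
vectors yields a signed stationary measure of the open ASEP. -/
theorem isStationaryASEP_of_matrix_ansatz {K : Type*} [AddCommGroup K] [Module ℝ K]
    {N : ℕ} {α β γ δ q κ : ℝ} (M : Bool → Module.End ℝ K) (w : K →ₗ[ℝ] ℝ) (V : K)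
    (hM : M true * M false - q • (M false * M true) = κ • (M true + M false))
    (hw : ∀ f, α * w (M false f) - γ * w (M true f) = κ * w f)
    (hV : β • M true V - δ • M false V = κ • V) :
    IsStationaryASEP N α β γ δ q fun τ => w (wordOp M τ V) := by
  intro τ
  set G : (Fin N → Bool) → ℝ := fun τ => w (wordOp M τ V) with hG
  rw [sum_mul_asepGen, sum_mul_asepJump, sum_asepJump]
  let r : Fin N → ℝ := fun i =>
    (if τ i = true then 1 else -1) * w ((leftOp M τ i * rightOp M τ i) V)
  have hM' : ∀ f, M true (M false f) = q • M false (M true f) + κ • (M true f + M false f) := by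
    intro f
    have := LinearMap.congr_fun hM f
    simp only [LinearMap.sub_apply, LinearMap.smul_apply, LinearMap.add_apply,
      Module.End.mul_apply] at this
    rw [← this]; abel
  have bulk : ∀ i j : Fin N, (j : ℕ) = i + 1 →
      ((if τ i = false ∧ τ j = true then
          G (Function.update (Function.update τ i true) j false) else 0) +
        q * (if τ i = true ∧ τ j = false then
          G (Function.update (Function.update τ i false) j true) else 0)) -
      G τ * ((if τ i = true ∧ τ j = false then 1 else 0) +
        q * (if τ i = false ∧ τ j = true then 1 else 0)) = κ * (r j - r i) := by
    intro i j hij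
    have hu : ∀ b b', G (Function.update (Function.update τ i b) j b') =
        w (leftOp M τ i (M b (M b' (rightOp M τ j V)))) := fun b b' => by
      rw [hG]
      simp only [wordOp_update_update M hij, Module.End.mul_apply]
    have hG' : G τ = w (leftOp M τ i (M (τ i) (M (τ j) (rightOp M τ j V)))) := by
      rw [hG]
      simp only [wordOp_eq_of_val_eq_add_one M hij τ, Module.End.mul_apply]
    simp only [hu, hG', r, leftOp_of_val_eq_add_one M τ hij, rightOp_of_val_eq_add_one M τ hij, Module.End.mul_apply]
    rcases hi : τ i with _ | _ <;> rcases hj : τ j with _ | _ <;>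
      simp [hM'] <;> ring
  have left : ∀ i : Fin N, (i : ℕ) = 0 →
      (α * (if τ i = true then G (Function.update τ i false) else 0) +
        γ * (if τ i = false then G (Function.update τ i true) else 0)) -
      G τ * (α * (if τ i = false then 1 else 0) + γ * (if τ i = true then 1 else 0)) =
        κ * r i := by
    intro i hi
    have hl : leftOp M τ i = 1 := by simp [leftOp, hi]
    have := hw (rightOp M τ i V)
    simp only [hG, r, wordOp_update, wordOp_eq M τ i, hl, Module.End.mul_apply,
      Module.End.one_apply]
    rcases hi : τ i with _ | _ <;> simp <;> linarith
  have right : ∀ i : Fin N, (i : ℕ) = N - 1 →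
      (δ * (if τ i = true then G (Function.update τ i false) else 0) +
        β * (if τ i = false then G (Function.update τ i true) else 0)) -
      G τ * (δ * (if τ i = false then 1 else 0) + β * (if τ i = true then 1 else 0)) =
        -(κ * r i) := by
    intro i hi
    have hl : rightOp M τ i = 1 := by
      have := i.isLt
      rw [rightOp, List.drop_eq_nil_of_le (by simp; omega), List.prod_nil]
    have := congrArg (fun f => w (leftOp M τ i f)) hV
    simp only [map_sub, map_smul, smul_eq_mul] at this
    simp only [hG, r, wordOp_update, wordOp_eq M τ i, hl, Module.End.mul_apply,
      Module.End.one_apply]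
    rcases hi : τ i with _ | _ <;> simp <;> linarith
  rw [mul_add, mul_add, add_sub_add_comm, add_sub_add_comm]
  simp only [Finset.mul_sum, ← Finset.sum_sub_distrib]
  have key := congrArg (κ * ·) (sum_fin_telescope r)
  simp only [mul_add, mul_sub, Finset.mul_sum, mul_zero] at key
  refine Eq.trans ?_ key
  rw [sub_eq_add_neg, ← Finset.sum_neg_distrib]
  congr 1
  · congr 1
    · refine Finset.sum_congr rfl fun i _ => Finset.sum_congr rfl fun j _ => ?_
      by_cases h : (j : ℕ) = i + 1
      · simpa only [if_pos h] using bulk i j h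
      · simp [h]
    · refine Finset.sum_congr rfl fun i _ => ?_
      by_cases h : (i : ℕ) = 0
      · simpa only [if_pos h] using left i h
      · simp [h]
  · refine Finset.sum_congr rfl fun i _ => ?_
    by_cases h : (i : ℕ) = N - 1
    · simpa only [if_pos h] using right i h
    · simp [h]

section Parameters

variable {q x y : ℝ}

theorem phiPlus_nonneg (hx : 0 < x) (hy : 0 ≤ y) : 0 ≤ phiPlus q x y := by
  unfold phiPlus
  have hxy := mul_nonneg hx.le hy
  have h : |1 - q - x + y| ≤ √((1 - q - x + y) ^ 2 + 4 * x * y) :=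
    Real.abs_le_sqrt (by nlinarith)
  have := neg_abs_le (1 - q - x + y)
  exact mul_nonneg (by positivity) (by linarith)

theorem phiMinus_nonpos (hx : 0 < x) (hy : 0 ≤ y) : phiMinus q x y ≤ 0 := by
  unfold phiMinus
  have hxy := mul_nonneg hx.le hy
  have h : |1 - q - x + y| ≤ √((1 - q - x + y) ^ 2 + 4 * x * y) :=
    Real.abs_le_sqrt (by nlinarith)
  have := le_abs_self (1 - q - x + y)
  exact mul_nonpos_of_nonneg_of_nonpos (by positivity) (by linarith)

theorem neg_one_lt_phiMinus (hx : 0 < x) (hy : 0 ≤ y) (hq : q < 1) : -1 < phiMinus q x y := by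
  unfold phiMinus
  have h : √((1 - q - x + y) ^ 2 + 4 * x * y) < 1 - q + x + y := by
    rw [Real.sqrt_lt' (by linarith)]
    nlinarith [mul_pos hx (sub_pos.mpr hq)]
  rw [one_div, ← div_eq_inv_mul, lt_div_iff₀ (by positivity)]
  linarith

theorem mul_phiPlus_mul_phiMinus (hx : 0 < x) (hy : 0 ≤ y) :
    x * phiPlus q x y * phiMinus q x y = -y := by
  have h := Real.sq_sqrt (show 0 ≤ (1 - q - x + y) ^ 2 + 4 * x * y by
    have := mul_nonneg hx.le hy
    nlinarith [sq_nonneg (1 - q - x + y)])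
  unfold phiPlus phiMinus
  generalize √((1 - q - x + y) ^ 2 + 4 * x * y) = s at h ⊢
  field_simp
  linear_combination -h

theorem mul_one_add_phiPlus_mul_one_add_phiMinus (hx : 0 < x) (hy : 0 ≤ y) :
    x * (1 + phiPlus q x y) * (1 + phiMinus q x y) = 1 - q := by
  have h := mul_phiPlus_mul_phiMinus (q := q) hx hy
  have h' : x * (phiPlus q x y + phiMinus q x y) = 1 - q - x + y := by
    unfold phiPlus phiMinus
    field_simp
    ring
  linear_combination h + h'

end Parameters

section Operators

/-- The operator attached to an occupied site, acting on functions of the gap between layers. -/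
noncomputable def occupiedOp (q d : ℝ) : Module.End ℝ (ℕ → ℝ) where
  toFun f x := (1 + d * q ^ x) * f x + (1 - q ^ (x + 1)) * f (x + 1)
  map_add' f g := by ext x; simp only [Pi.add_apply]; ring
  map_smul' r f := by ext x; simp only [Pi.smul_apply, smul_eq_mul, RingHom.id_apply]; ring

/-- The operator attached to an empty site, acting on functions of the gap between layers. -/
noncomputable def emptyOp (q c d : ℝ) : Module.End ℝ (ℕ → ℝ) where
  toFun f x := (1 + c * q ^ x) * f x + if x = 0 then 0 else (1 - c * d * q ^ (x - 1)) * f (x - 1)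
  map_add' f g := by
    ext x
    by_cases hx : x = 0 <;> simp only [Pi.add_apply, hx, if_true, if_false] <;> ring
  map_smul' r f := by
    ext x
    by_cases hx : x = 0 <;>
      simp only [Pi.smul_apply, smul_eq_mul, RingHom.id_apply, hx, if_true, if_false] <;> ring

/-- The one-site operators of the matrix product representation. -/
noncomputable def siteOp (q c d : ℝ) (t : Bool) : Module.End ℝ (ℕ → ℝ) :=
  if t = true then occupiedOp q d else emptyOp q c d

theorem siteOp_true_apply (q c d : ℝ) (f : ℕ → ℝ) (x : ℕ) :
    siteOp q c d true f x = (1 + d * q ^ x) * f x + (1 - q ^ (x + 1)) * f (x + 1) := rfl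

theorem siteOp_false_apply_zero (q c d : ℝ) (f : ℕ → ℝ) :
    siteOp q c d false f 0 = (1 + c) * f 0 := by
  simp [siteOp, emptyOp]

theorem siteOp_false_apply_succ (q c d : ℝ) (f : ℕ → ℝ) (x : ℕ) :
    siteOp q c d false f (x + 1) =
      (1 + c * q ^ (x + 1)) * f (x + 1) + (1 - c * d * q ^ x) * f x := by
  simp [siteOp, emptyOp]

theorem siteOp_quadratic (q c d : ℝ) (f : ℕ → ℝ) :
    siteOp q c d true (siteOp q c d false f) - q • siteOp q c d false (siteOp q c d true f) =
      (1 - q) • (siteOp q c d true f + siteOp q c d false f) := by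
  ext x
  cases x with
  | zero =>
    simp only [Pi.sub_apply, Pi.smul_apply, Pi.add_apply, smul_eq_mul, siteOp_true_apply,
      siteOp_false_apply_zero, siteOp_false_apply_succ]
    ring
  | succ x =>
    simp only [Pi.sub_apply, Pi.smul_apply, Pi.add_apply, smul_eq_mul, siteOp_true_apply,
      siteOp_false_apply_succ]
    ring

/-- The functions that are summable against the geometric weight `a ^ x`. -/
noncomputable def geomSummable (a : ℝ) : Submodule ℝ (ℕ → ℝ) where
  carrier := {f | Summable fun x => a ^ x * f x}
  add_mem' {f g} hf hg := by
    simpa only [Set.mem_ofPred_eq, Pi.add_apply, mul_add] using Summable.add hf hg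
  zero_mem' := by simp
  smul_mem' r f hf := by
    simpa only [Set.mem_ofPred_eq, Pi.smul_apply, smul_eq_mul, mul_left_comm _ r] using
      Summable.mul_left r hf

variable {q : ℝ}

theorem Summable.pow_mul_of_le_one (hq0 : 0 ≤ q) (hq1 : q ≤ 1) {g : ℕ → ℝ} (hg : Summable g) :
    Summable fun x => q ^ x * g x := by
  refine Summable.of_norm_bounded hg.norm fun x => ?_
  rw [norm_mul, Real.norm_of_nonneg (pow_nonneg hq0 x)]
  exact mul_le_of_le_one_left (norm_nonneg _) (pow_le_one₀ hq0 hq1)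

theorem summable_pow_mul_shift {a : ℝ} {f : ℕ → ℝ} (hf : Summable fun x => a ^ x * f x) :
    Summable fun x => a ^ x * f (x + 1) := by
  by_cases ha : a = 0
  · subst ha
    refine summable_of_ne_finset_zero (s := {0}) fun x hx => ?_
    simp [zero_pow (by simpa using hx : x ≠ 0)]
  · refine (((summable_nat_add_iff 1).mpr hf).mul_left a⁻¹).congr fun x => ?_
    rw [pow_succ']
    field_simp

theorem siteOp_mem_geomSummable (hq0 : 0 ≤ q) (hq1 : q ≤ 1) (a c d : ℝ) (t : Bool)
    (f : ℕ → ℝ) (hf : f ∈ geomSummable a) : siteOp q c d t f ∈ geomSummable a := by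
  change Summable _ at hf
  have hq := hf.pow_mul_of_le_one hq0 hq1
  change Summable _
  cases t with
  | true =>
    have hs := summable_pow_mul_shift hf
    have hqs := hs.pow_mul_of_le_one hq0 hq1
    refine ((hf.add (hq.mul_left d)).add (hs.sub (hqs.mul_left q))).congr fun x => ?_
    rw [siteOp_true_apply]
    ring
  | false =>
    have hs := hf.mul_left a
    have hqs := hq.mul_left a
    rw [← summable_nat_add_iff 1]
    refine (((summable_nat_add_iff 1).mpr (hf.add (hq.mul_left c))).add
      (hs.sub (hqs.mul_left (c * d)))).congr fun x => ?_
    rw [siteOp_false_apply_succ]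
    ring

/-- The one-site operators restricted to `geomSummable a`. -/
noncomputable def siteOpRestrict (hq0 : 0 ≤ q) (hq1 : q ≤ 1) (a c d : ℝ) (t : Bool) :
    Module.End ℝ (geomSummable a) :=
  (siteOp q c d t).restrict (siteOp_mem_geomSummable hq0 hq1 a c d t)

/-- The left boundary functional `f ↦ ∑ₓ aˣ f(x)`. -/
noncomputable def leftFunctional (a : ℝ) : geomSummable a →ₗ[ℝ] ℝ where
  toFun f := ∑' x, a ^ x * f.1 x
  map_add' f g := by
    rw [← Summable.tsum_add f.2 g.2]
    simp [mul_add]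
  map_smul' r f := by
    simp [mul_left_comm _ r, tsum_mul_left]

theorem leftFunctional_boundary (hq0 : 0 ≤ q) (hq1 : q ≤ 1) {a c d α γ : ℝ}
    (hγ : α * a * c = -γ) (hα : α * (1 + a) * (1 + c) = 1 - q) (f : geomSummable a) :
    α * leftFunctional a (siteOpRestrict hq0 hq1 a c d false f) -
      γ * leftFunctional a (siteOpRestrict hq0 hq1 a c d true f) =
      (1 - q) * leftFunctional a f := by
  obtain ⟨f, hf⟩ := f
  have hF := siteOp_mem_geomSummable hq0 hq1 a c d false f hf
  have hT := siteOp_mem_geomSummable hq0 hq1 a c d true f hf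
  change Summable _ at hf hF hT
  change α * (∑' x, a ^ x * siteOp q c d false f x) - γ * (∑' x, a ^ x * siteOp q c d true f x) =
    (1 - q) * ∑' x, a ^ x * f x
  have hq := hf.pow_mul_of_le_one hq0 hq1
  have h₁ : ∑' x, a ^ x * siteOp q c d false f x =
      ∑' x, a ^ x * f x + c * ∑' x, q ^ x * (a ^ x * f x) +
        a * (∑' x, a ^ x * f x - c * d * ∑' x, q ^ x * (a ^ x * f x)) := by
    have hs := hf.add (hq.mul_left c)
    rw [← tsum_mul_left, ← tsum_mul_left, ← Summable.tsum_add hf (hq.mul_left c),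
      ← Summable.tsum_sub hf (hq.mul_left (c * d)), ← tsum_mul_left, hF.tsum_eq_zero_add,
      hs.tsum_eq_zero_add, add_assoc, ← Summable.tsum_add ((summable_nat_add_iff 1).mpr hs)
        ((hf.sub (hq.mul_left (c * d))).mul_left a)]
    congr 1
    · rw [siteOp_false_apply_zero]; ring
    · congr 1
      ext x
      rw [siteOp_false_apply_succ]
      ring
  have h₂ : a * ∑' x, a ^ x * siteOp q c d true f x =
      a * (∑' x, a ^ x * f x + d * ∑' x, q ^ x * (a ^ x * f x)) +
        (∑' x, a ^ x * f x - ∑' x, q ^ x * (a ^ x * f x)) := by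
    have hs := hf.sub hq
    rw [← tsum_mul_left, ← tsum_mul_left, ← Summable.tsum_add hf (hq.mul_left d),
      ← Summable.tsum_sub hf hq, ← tsum_mul_left, hs.tsum_eq_zero_add, pow_zero q, one_mul,
      sub_self, zero_add, ← Summable.tsum_add ((hf.add (hq.mul_left d)).mul_left a)
        ((summable_nat_add_iff 1).mpr hs)]
    congr 1
    ext x
    rw [siteOp_true_apply]
    ring
  linear_combination α * h₁ + α * c * h₂ + (∑' x, a ^ x * f x) * hα -
    (∑' x, a ^ x * siteOp q c d true f x) * hγ

theorem qPoch_succ (z q : ℝ) (n : ℕ) : qPoch z q (n + 1) = qPoch z q n * (1 - z * q ^ n) :=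
  Finset.prod_range_succ _ _

theorem qPoch_pos {z : ℝ} (hq0 : 0 ≤ q) (hq1 : q ≤ 1) (hz0 : 0 ≤ z) (hz1 : z < 1) (n : ℕ) :
    0 < qPoch z q n :=
  Finset.prod_pos fun _ _ => sub_pos.mpr
    ((mul_le_of_le_one_right hz0 (pow_le_one₀ hq0 hq1)).trans_lt hz1)

/-- The right boundary vector `x ↦ bˣ (cd;q)ₓ / (q;q)ₓ`. -/
noncomputable def rightVec (q b c d : ℝ) (x : ℕ) : ℝ :=
  b ^ x * (qPoch (c * d) q x / qPoch q q x)

theorem rightVec_succ (hq0 : 0 ≤ q) (hq1 : q < 1) (b c d : ℝ) (x : ℕ) :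
    (1 - q ^ (x + 1)) * rightVec q b c d (x + 1) =
      b * (1 - c * d * q ^ x) * rightVec q b c d x := by
  have h := (qPoch_pos hq0 hq1.le hq0 hq1 x).ne'
  have h' : 1 - q * q ^ x ≠ 0 := by
    rw [← pow_succ']
    exact (sub_pos.mpr (pow_lt_one₀ hq0 hq1 (by simp))).ne'
  simp only [rightVec, qPoch_succ, pow_succ']
  field_simp

theorem rightVec_boundary (hq0 : 0 ≤ q) (hq1 : q < 1) {b c d β δ : ℝ}
    (hδ : β * b * d = -δ) (hβ : β * (1 + b) * (1 + d) = 1 - q) :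
    β • siteOp q c d true (rightVec q b c d) - δ • siteOp q c d false (rightVec q b c d) =
      (1 - q) • rightVec q b c d := by
  obtain rfl : δ = -(β * b * d) := by linarith
  ext x
  simp only [Pi.sub_apply, Pi.smul_apply, smul_eq_mul, siteOp_true_apply, ← hβ]
  rw [rightVec_succ hq0 hq1]
  cases x with
  | zero =>
    rw [siteOp_false_apply_zero]
    ring
  | succ x =>
    rw [siteOp_false_apply_succ]
    have := rightVec_succ hq0 hq1 b c d x
    linear_combination -(β * d) * this

theorem rightVec_mem_geomSummable (hq0 : 0 ≤ q) (hq1 : q < 1) {a b c d : ℝ} (ha : 0 ≤ a)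
    (hb : 0 ≤ b) (hab : a * b < 1) (hcd0 : 0 ≤ c * d) (hcd1 : c * d < 1) :
    rightVec q b c d ∈ geomSummable a := by
  change Summable _
  obtain ⟨r, hr, hr1⟩ := exists_between hab
  have hr0 : 0 < r := (mul_nonneg ha hb).trans_lt hr
  refine summable_of_ratio_norm_eventually_le hr1 ?_
  have hlim : Filter.Tendsto (fun n : ℕ => r * (1 - q ^ (n + 1))) Filter.atTop (nhds r) := by
    have := (tendsto_pow_atTop_nhds_zero_of_lt_one hq0 hq1).comp (Filter.tendsto_add_atTop_nat 1)
    simpa using (this.const_sub 1).const_mul r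
  filter_upwards [hlim.eventually_const_lt hr] with n hn
  have hpos : ∀ k, 0 ≤ rightVec q b c d k := fun k =>
    mul_nonneg (pow_nonneg hb k) (div_nonneg (qPoch_pos hq0 hq1.le hcd0 hcd1 k).le
      (qPoch_pos hq0 hq1.le hq0 hq1 k).le)
  have h := rightVec_succ hq0 hq1 b c d n
  have hq' : 0 < 1 - q ^ (n + 1) := sub_pos.mpr (pow_lt_one₀ hq0 hq1 (by simp))
  rw [Real.norm_of_nonneg (mul_nonneg (pow_nonneg ha _) (hpos _)),
    Real.norm_of_nonneg (mul_nonneg (pow_nonneg ha _) (hpos _))]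
  refine le_of_mul_le_mul_left ?_ hq'
  have ht : 0 ≤ a ^ n * rightVec q b c d n := mul_nonneg (pow_nonneg ha _) (hpos _)
  have hab0 := mul_nonneg ha hb
  have hle : a * b * (1 - c * d * q ^ n) ≤ r * (1 - q ^ (n + 1)) :=
    (mul_le_of_le_one_right hab0 (by nlinarith [pow_nonneg hq0 n])).trans hn.le
  calc (1 - q ^ (n + 1)) * (a ^ (n + 1) * rightVec q b c d (n + 1))
      = a ^ (n + 1) * ((1 - q ^ (n + 1)) * rightVec q b c d (n + 1)) := by ring
    _ = a * b * (1 - c * d * q ^ n) * (a ^ n * rightVec q b c d n) := by rw [h]; ring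
    _ ≤ r * (1 - q ^ (n + 1)) * (a ^ n * rightVec q b c d n) :=
        mul_le_mul_of_nonneg_right hle ht
    _ = _ := by ring

end Operators

section Paths

/-- The increment `0` or `1` encoded by a Boolean. -/
def boolStep (t : Bool) : ℤ := if t = true then 1 else 0

/-- The gap at site `j` between the paths with increments `τ` and `σ`, started at gap `x`. -/
def pathGap {N : ℕ} (τ σ : Fin N → Bool) (x : ℤ) (j : Fin (N + 1)) : ℤ :=
  x + Fin.partialSum (fun i => boolStep (τ i)) j - Fin.partialSum (fun i => boolStep (σ i)) j

/-- The weight of a pair of paths with increments `τ`, `σ`, started at gap `x`, with terminal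
weight `V`; it vanishes unless the paths are ordered. -/
noncomputable def gapWeight (q c d : ℝ) (V : ℕ → ℝ) {N : ℕ} (τ σ : Fin N → Bool) (x : ℤ) : ℝ :=
  if ∀ j, 0 ≤ pathGap τ σ x j then
    V (pathGap τ σ x (Fin.last N)).toNat *
      ∏ j : Fin N, Wfac q c d (pathGap τ σ x j.succ) (boolStep (τ j)) (boolStep (σ j))
  else 0

theorem pathGap_zero {N : ℕ} (τ σ : Fin N → Bool) (x : ℤ) : pathGap τ σ x 0 = x := by
  simp [pathGap]

theorem pathGap_succ {N : ℕ} (τ σ : Fin (N + 1) → Bool) (x : ℤ) (j : Fin (N + 1)) :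
    pathGap τ σ x j.succ =
      pathGap (Fin.tail τ) (Fin.tail σ) (x + boolStep (τ 0) - boolStep (σ 0)) j := by
  simp only [pathGap, Fin.partialSum_succ']
  simp only [Fin.tail_def]
  ring

variable (q c d : ℝ) (V : ℕ → ℝ)

theorem gapWeight_of_neg {N : ℕ} (τ σ : Fin N → Bool) {x : ℤ} (hx : x < 0) :
    gapWeight q c d V τ σ x = 0 := by
  rw [gapWeight, if_neg]
  intro h
  have := h 0
  rw [pathGap_zero] at this
  omega

theorem gapWeight_succ {N : ℕ} (τ σ : Fin (N + 1) → Bool) {x : ℤ} (hx : 0 ≤ x) :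
    gapWeight q c d V τ σ x =
      Wfac q c d (x + boolStep (τ 0) - boolStep (σ 0)) (boolStep (τ 0)) (boolStep (σ 0)) *
        gapWeight q c d V (Fin.tail τ) (Fin.tail σ) (x + boolStep (τ 0) - boolStep (σ 0)) := by
  unfold gapWeight
  simp only [Fin.forall_fin_succ (n := N + 1), pathGap_zero, hx, true_and, pathGap_succ,
    Fin.prod_univ_succ (n := N), ← Fin.succ_last]
  split_ifs
  · simp only [Fin.tail]
    ring
  · simp

theorem sum_gapWeight {q : ℝ} (hq0 : 0 ≤ q) (hq1 : q ≤ 1) (a c d : ℝ) (V : geomSummable a)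
    {N : ℕ} (τ : Fin N → Bool) (x : ℕ) :
    ∑ σ, gapWeight q c d V.1 τ σ x = (wordOp (siteOpRestrict hq0 hq1 a c d) τ V).1 x := by
  induction N generalizing x with
  | zero => simp [gapWeight, pathGap, wordOp]
  | succ N ih =>
    have hsplit : ∑ σ, gapWeight q c d V.1 τ σ x = ∑ s : Bool,
        Wfac q c d (x + boolStep (τ 0) - boolStep s) (boolStep (τ 0)) (boolStep s) *
          ∑ σ, gapWeight q c d V.1 (Fin.tail τ) σ (x + boolStep (τ 0) - boolStep s) := by
      rw [← (Fin.consEquiv fun _ => Bool).sum_comp, Fintype.sum_prod_type]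
      refine Finset.sum_congr rfl fun s _ => ?_
      rw [Finset.mul_sum]
      refine Finset.sum_congr rfl fun σ _ => ?_
      rw [gapWeight_succ _ _ _ _ _ _ (by positivity)]
      simp [Fin.consEquiv]
    have hcoe : (wordOp (siteOpRestrict hq0 hq1 a c d) τ V).1 = siteOp q c d (τ 0)
        (wordOp (siteOpRestrict hq0 hq1 a c d) (Fin.tail τ) V).1 := by
      rw [wordOp_succ]
      rfl
    rw [hsplit, hcoe, Fintype.sum_bool]
    cases τ 0 with
    | true =>
      have h := ih (Fin.tail τ) (x + 1)
      push_cast at h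
      simp [boolStep, siteOp_true_apply, ih, h, Wfac]
    | false =>
      cases x with
      | zero => simp [boolStep, siteOp_false_apply_zero, ← ih, Wfac, gapWeight_of_neg]
      | succ x =>
        have h := ih (Fin.tail τ) (x + 1)
        push_cast at h
        simp [boolStep, siteOp_false_apply_succ, ih, h, Wfac]
        norm_cast
        ring

/-- The pair of paths with increments `τ`, `σ` and initial gap `x`. -/
def pathPair {N : ℕ} (τ : Fin N → Bool) (p : ℕ × (Fin N → Bool)) :
    (Fin (N + 1) → ℤ) × (Fin (N + 1) → ℤ) :=
  (Fin.partialSum fun i => boolStep (τ i),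
    fun j => Fin.partialSum (fun i => boolStep (p.2 i)) j - p.1)

/-- The pairs of functions whose first component has increments `τ`. -/
def firstLayer {N : ℕ} (τ : Fin N → Bool) : Set ((Fin (N + 1) → ℤ) × (Fin (N + 1) → ℤ)) :=
  {p' | ∀ j : Fin N, p'.1 j.succ - p'.1 j.castSucc = (if τ j = true then 1 else 0)}

theorem boolStep_injective : Function.Injective boolStep := by
  intro s t
  cases s <;> cases t <;> simp [boolStep]

theorem pathPair_injective {N : ℕ} (τ : Fin N → Bool) : Function.Injective (pathPair τ) := by
  rintro ⟨x, σ⟩ ⟨y, ρ⟩ h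
  have h₂ := fun j => congrFun (congrArg Prod.snd h) j
  simp only [pathPair] at h₂
  have hx := h₂ 0
  simp only [Fin.partialSum_zero] at hx
  obtain rfl : x = y := by omega
  congr 1
  ext1 i
  apply boolStep_injective
  have h₃ := h₂ i.succ
  have h₄ := h₂ i.castSucc
  rw [Fin.partialSum_succ, Fin.partialSum_succ] at h₃
  linarith

theorem pathPair_mem_firstLayer {N : ℕ} (τ : Fin N → Bool) (p : ℕ × (Fin N → Bool)) :
    pathPair τ p ∈ firstLayer τ := by
  intro j
  simp [pathPair, Fin.partialSum_succ, boolStep]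

theorem pathPair_gap {N : ℕ} (τ : Fin N → Bool) (p : ℕ × (Fin N → Bool)) (j : Fin (N + 1)) :
    (pathPair τ p).1 j - (pathPair τ p).2 j = pathGap τ p.2 p.1 j := by
  simp only [pathPair, pathGap]
  ring

theorem isBPath_partialSum {N : ℕ} (τ : Fin N → Bool) (x : ℤ) :
    IsBPath N fun j => Fin.partialSum (fun i => boolStep (τ i)) j - x := by
  intro j
  simp only [Fin.partialSum_succ]
  cases τ j
  · left; simp [boolStep]
  · right; simp [boolStep]; ring

theorem pathPair_mem_TLset {N : ℕ} (τ : Fin N → Bool) (p : ℕ × (Fin N → Bool)) :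
    pathPair τ p ∈ TLset N ↔ ∀ j, 0 ≤ pathGap τ p.2 p.1 j := by
  simp only [← pathPair_gap, sub_nonneg]
  refine ⟨fun h => h.2.1, fun h => ⟨by simp [pathPair], h, ?_, isBPath_partialSum _ _⟩⟩
  simpa [pathPair] using isBPath_partialSum τ 0

theorem mem_range_pathPair {N : ℕ} (τ : Fin N → Bool) {p : (Fin (N + 1) → ℤ) × (Fin (N + 1) → ℤ)}
    (hp : p ∈ TLset N) (hτ : p ∈ firstLayer τ) : p ∈ Set.range (pathPair τ) := by
  obtain ⟨h₀, hle, -, h₂⟩ := hp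
  refine ⟨((-p.2 0).toNat, fun j => decide (p.2 j.succ = p.2 j.castSucc + 1)), ?_⟩
  have hle0 := hle 0
  rw [h₀] at hle0
  refine Prod.ext (funext fun j => ?_) (funext fun j => ?_)
  · induction j using Fin.induction with
    | zero => simp [pathPair, h₀]
    | succ j ih =>
      have := hτ j
      simp only [pathPair, Fin.partialSum_succ, boolStep] at ih ⊢
      omega
  · induction j using Fin.induction with
    | zero => simp [pathPair]; omega
    | succ j ih =>
      have := h₂ j
      simp only [pathPair, Fin.partialSum_succ, boolStep, decide_eq_true_eq] at ih ⊢
      split_ifs <;> omega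

theorem twt_pathPair {N : ℕ} (q a b c d : ℝ) (τ : Fin N → Bool) (p : ℕ × (Fin N → Bool)) :
    (TLset N).indicator ((firstLayer τ).indicator (twt N q a b c d)) (pathPair τ p) =
      a ^ p.1 * gapWeight q c d (rightVec q b c d) τ p.2 p.1 := by
  have hinc₁ : ∀ j : Fin N, (pathPair τ p).1 j.succ - (pathPair τ p).1 j.castSucc =
      boolStep (τ j) := fun j => by simp [pathPair, Fin.partialSum_succ]
  have hinc₂ : ∀ j : Fin N, (pathPair τ p).2 j.succ - (pathPair τ p).2 j.castSucc =
      boolStep (p.2 j) := fun j => by simp [pathPair, Fin.partialSum_succ]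
  by_cases h : pathPair τ p ∈ TLset N
  · rw [Set.indicator_of_mem h, Set.indicator_of_mem (pathPair_mem_firstLayer τ p), gapWeight,
      if_pos ((pathPair_mem_TLset τ p).mp h)]
    simp only [twt, hinc₁, hinc₂, pathPair_gap, pathGap_zero, rightVec, Int.toNat_natCast]
    ring
  · rw [Set.indicator_of_notMem h, gapWeight, if_neg (mt (pathPair_mem_TLset τ p).mpr h),
      mul_zero]

variable {q c d}

theorem Wfac_nonneg (hq0 : 0 ≤ q) (hq1 : q ≤ 1) (hc : -1 < c) (hc' : c ≤ 0) (hd : -1 < d)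
    (hd' : d ≤ 0) (x u v : ℤ) : 0 ≤ Wfac q c d x u v := by
  have h0 : 0 ≤ q ^ x.toNat := pow_nonneg hq0 _
  have h1 : q ^ x.toNat ≤ 1 := pow_le_one₀ hq0 hq1
  unfold Wfac
  split_ifs
  · linarith
  · nlinarith
  · nlinarith
  · have : c * d ≤ 1 := by nlinarith
    nlinarith [mul_nonneg_of_nonpos_of_nonpos hc' hd']

theorem twt_nonneg (hq0 : 0 ≤ q) (hq1 : q < 1) {a b : ℝ} (ha : 0 ≤ a) (hb : 0 ≤ b)
    (hc : -1 < c) (hc' : c ≤ 0) (hd : -1 < d) (hd' : d ≤ 0) (N : ℕ)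
    (p : (Fin (N + 1) → ℤ) × (Fin (N + 1) → ℤ)) : 0 ≤ twt N q a b c d p := by
  have h₁ := (qPoch_pos hq0 hq1.le (mul_nonneg_of_nonpos_of_nonpos hc' hd') (by nlinarith)
    (p.1 (Fin.last N) - p.2 (Fin.last N)).toNat).le
  have h₂ := (qPoch_pos hq0 hq1.le hq0 hq1 (p.1 (Fin.last N) - p.2 (Fin.last N)).toNat).le
  exact mul_nonneg (mul_nonneg (by positivity) (div_nonneg h₁ h₂))
    (Finset.prod_nonneg fun j _ => Wfac_nonneg hq0 hq1.le hc hc' hd hd' _ _ _)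

/-- The total weight of the two-layer configurations with first layer `τ` is the matrix product
associated with `τ`. -/
theorem hasSum_firstLayer_twt (hq0 : 0 ≤ q) (hq1 : q < 1) {a b : ℝ} (ha : 0 ≤ a) (hb : 0 ≤ b)
    (hc : -1 < c) (hc' : c ≤ 0) (hd : -1 < d) (hd' : d ≤ 0)
    (hV : rightVec q b c d ∈ geomSummable a) {N : ℕ} (τ : Fin N → Bool) :
    HasSum (fun p : TLset N => (firstLayer τ).indicator (twt N q a b c d) p.val)
      (leftFunctional a (wordOp (siteOpRestrict hq0 hq1.le a c d) τ ⟨_, hV⟩)) := by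
  refine (hasSum_subtype_iff_indicator (f := (firstLayer τ).indicator (twt N q a b c d))).mpr ?_
  rw [← (pathPair_injective τ).hasSum_iff]
  swap
  · intro p hp
    by_contra h
    have h' := Set.mem_of_indicator_ne_zero h
    rw [Set.indicator_of_mem h'] at h
    exact hp (mem_range_pathPair τ h' (Set.mem_of_indicator_ne_zero h))
  have hcomp : (TLset N).indicator ((firstLayer τ).indicator (twt N q a b c d)) ∘ pathPair τ =
      fun p => a ^ p.1 * gapWeight q c d (rightVec q b c d) τ p.2 p.1 :=
    funext fun p => twt_pathPair q a b c d τ p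
  have hnonneg : (0 : ℕ × (Fin N → Bool) → ℝ) ≤
      fun p => a ^ p.1 * gapWeight q c d (rightVec q b c d) τ p.2 p.1 := by
    rw [← hcomp]
    exact fun p => Set.indicator_nonneg (fun _ _ => Set.indicator_nonneg
      (fun _ _ => twt_nonneg hq0 hq1 ha hb hc hc' hd hd' N _) _) _
  have hinner : ∀ x : ℕ, ∑' σ, a ^ x * gapWeight q c d (rightVec q b c d) τ σ x =
      a ^ x * (wordOp (siteOpRestrict hq0 hq1.le a c d) τ ⟨_, hV⟩).1 x := by
    intro x
    rw [tsum_fintype, ← Finset.mul_sum, ← sum_gapWeight]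
  have hsum : Summable fun p : ℕ × (Fin N → Bool) =>
      a ^ p.1 * gapWeight q c d (rightVec q b c d) τ p.2 p.1 := by
    rw [summable_prod_of_nonneg hnonneg]
    refine ⟨fun x => (hasSum_fintype _).summable, ?_⟩
    simp only [hinner]
    exact (wordOp (siteOpRestrict hq0 hq1.le a c d) τ ⟨_, hV⟩).2
  rw [hcomp]
  convert hsum.hasSum using 1
  rw [hsum.tsum_prod]
  simp only [hinner]
  rfl

theorem twt_zero_pos (hc : -1 < c) (q a b d : ℝ) (N : ℕ) : 0 < twt N q a b c d 0 := by
  have h : ∀ j : Fin N, 0 < Wfac q c d 0 0 0 := fun _ => by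
    simp [Wfac]; linarith
  simpa [twt, qPoch] using Finset.prod_pos fun j (_ : j ∈ Finset.univ) => h j

theorem zero_mem_TLset (N : ℕ) : (0 : (Fin (N + 1) → ℤ) × (Fin (N + 1) → ℤ)) ∈ TLset N := by
  simp [TLset, IsBPath]

theorem sum_indicator_firstLayer {N : ℕ} (g : (Fin (N + 1) → ℤ) × (Fin (N + 1) → ℤ) → ℝ)
    {p : (Fin (N + 1) → ℤ) × (Fin (N + 1) → ℤ)} (hp : p ∈ TLset N) :
    ∑ τ, (firstLayer τ).indicator g p = g p := by
  rw [Finset.sum_eq_single fun j => decide (p.1 j.succ = p.1 j.castSucc + 1)]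
  · refine Set.indicator_of_mem ?_ _
    intro j
    have := hp.2.2.1 j
    simp only [decide_eq_true_eq]
    split_ifs <;> omega
  · intro τ _ hτ
    refine Set.indicator_of_notMem (fun h => hτ ?_) _
    ext j
    have := h j
    cases hj : τ j <;> simp [hj] at this ⊢ <;> omega
  · simp

end Paths

/-- Theorem 2.4 (two-layer representation): the marginal on the increments of the first layer
of the two-layer measure `P_N^{(q,a,b,c,d)}` is a stationary probability measure for the open
ASEP; equivalently, the first layer has the same law as the height function of the open ASEP
stationary measure. -/
theorem stmt7 (α β γ δ q : ℝ)
    (hα : 0 < α) (hβ : 0 < β) (hγ : 0 ≤ γ) (hδ : 0 ≤ δ) (hq0 : 0 ≤ q) (hq1 : q < 1)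
    (a b c d : ℝ)
    (ha : a = phiPlus q α γ) (hb : b = phiPlus q β δ)
    (hc : c = phiMinus q α γ) (hd : d = phiMinus q β δ)
    (hab : a * b < 1) (N : ℕ)
    (μ : (Fin N → Bool) → ℝ)
    (hμ : ∀ τ : Fin N → Bool, μ τ =
      (∑' p : TLset N,
        Set.indicator
          {p' : (Fin (N+1) → ℤ) × (Fin (N+1) → ℤ) |
            ∀ j : Fin N, p'.1 j.succ - p'.1 j.castSucc = (if τ j = true then 1 else 0)}
          (twt N q a b c d) p.val) /
        ∑' p : TLset N, twt N q a b c d p.val) :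
    (∀ τ, 0 ≤ μ τ) ∧ (∑ τ : Fin N → Bool, μ τ = 1) ∧ IsStationaryASEP N α β γ δ q μ := by
  subst ha hb hc hd
  have hc := neg_one_lt_phiMinus hα hγ hq1
  have hc' := phiMinus_nonpos (q := q) hα hγ
  have hd := neg_one_lt_phiMinus hβ hδ hq1
  have hd' := phiMinus_nonpos (q := q) hβ hδ
  have ha := phiPlus_nonneg (q := q) hα hγ
  have hb := phiPlus_nonneg (q := q) hβ hδ
  have hαγ := mul_phiPlus_mul_phiMinus (q := q) hα hγ
  have hαγ' := mul_one_add_phiPlus_mul_one_add_phiMinus (q := q) hα hγ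
  have hβδ := mul_phiPlus_mul_phiMinus (q := q) hβ hδ
  have hβδ' := mul_one_add_phiPlus_mul_one_add_phiMinus (q := q) hβ hδ
  set a := phiPlus q α γ
  set b := phiPlus q β δ
  set c := phiMinus q α γ
  set d := phiMinus q β δ
  have hV := rightVec_mem_geomSummable hq0 hq1 ha hb hab
    (mul_nonneg_of_nonpos_of_nonpos hc' hd') (by nlinarith)
  have hsum := fun τ : Fin N → Bool =>
    hasSum_firstLayer_twt hq0 hq1 ha hb hc hc' hd hd' hV τ
  have hnonneg := twt_nonneg hq0 hq1 ha hb hc hc' hd hd' N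
  have hZ : HasSum (fun p : TLset N => twt N q a b c d p.val)
      (∑ τ : Fin N → Bool, leftFunctional a
        (wordOp (siteOpRestrict hq0 hq1.le a c d) τ ⟨_, hV⟩)) := by
    refine (hasSum_sum fun τ _ => hsum τ).congr_fun ?_
    exact fun p => (sum_indicator_firstLayer _ p.2).symm
  have hZpos : 0 < ∑' p : TLset N, twt N q a b c d p.val :=
    hZ.summable.tsum_pos (fun p => hnonneg p) ⟨0, zero_mem_TLset N⟩ (twt_zero_pos hc q a b d N)
  have hμ' : ∀ τ, μ τ = leftFunctional a
      (wordOp (siteOpRestrict hq0 hq1.le a c d) τ ⟨_, hV⟩) /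
        ∑' p : TLset N, twt N q a b c d p.val := fun τ => by
    rw [hμ τ, ← (hsum τ).tsum_eq]
    rfl
  refine ⟨fun τ => ?_, ?_, fun τ' => ?_⟩
  · rw [hμ τ]
    exact div_nonneg (tsum_nonneg fun p => Set.indicator_nonneg (fun _ _ => hnonneg _) _)
      hZpos.le
  · simp only [hμ']
    rw [← Finset.sum_div, ← hZ.tsum_eq, div_self hZpos.ne']
  · have hst := isStationaryASEP_of_matrix_ansatz (N := N)
      (siteOpRestrict hq0 hq1.le a c d) (leftFunctional a) ⟨_, hV⟩
      (LinearMap.ext fun f => Subtype.ext (siteOp_quadratic q c d f.1))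
      (leftFunctional_boundary hq0 hq1.le hαγ hαγ')
      (Subtype.ext (rightVec_boundary hq0 hq1 hβδ hβδ')) τ'
    simp only [hμ', div_mul_eq_mul_div]
    rw [← Finset.sum_div, hst, zero_div]
end

section
/- Let a,b≥0, −1<c,d≤0, 0≤q<1 with ab<1. Then lim_{N→∞} (1/N) log Z_N^{(q,a,b,c,d)} = −log J(a,b), where J(a,b) := a/(1+a)² if a>1, J(a,b) := b/(1+b)² if b>1, and J(a,b) := 1/4 if a≤1 and b≤1. -/
/-- The normalization constant `Z_N^{(q,a,b,c,d)}`. -/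
noncomputable def Zconst (N : ℕ) (q a b c d : ℝ) : ℝ := ∑' p : TLset N, twt N q a b c d p.val

/-- `J(a,b)`. -/
noncomputable def Jfun (a b : ℝ) : ℝ :=
  if 1 < a then a / (1 + a) ^ 2 else if 1 < b then b / (1 + b) ^ 2 else 1 / 4

/-- The reversible measure of the two-layer difference process. -/
noncomputable def revMeasure (q c d : ℝ) (n : ℕ) : ℝ := qPoch (c * d) q n / qPoch q q n

/-- The one-step operator of the two-layer difference process,
symmetric with respect to `revMeasure`. -/
noncomputable def stepOp (q c d : ℝ) (h : ℕ → ℝ) (n : ℕ) : ℝ :=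
  (1 - q ^ n) * h (n - 1) + ((1 + c * q ^ n) + (1 + d * q ^ n)) * h n
    + (1 - c * d * q ^ n) * h (n + 1)

/-- The difference of the two layers at position `j`. -/
def layerGap {N : ℕ} (p : (Fin (N + 1) → ℤ) × (Fin (N + 1) → ℤ)) (j : Fin (N + 1)) : ℕ :=
  (p.1 j - p.2 j).toNat

/-- Total weight of two-layer configurations with boundary weights `f` and `revMeasure * h`. -/
noncomputable def pathSum (q c d : ℝ) (N : ℕ) (f h : ℕ → ℝ) : ENNReal :=
  ∑' p : TLset N, ENNReal.ofReal
    (f (layerGap p.val 0) * (∏ j : Fin N, Wfac q c d (p.val.1 j.succ - p.val.2 j.succ)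
      (p.val.1 j.succ - p.val.1 j.castSucc) (p.val.2 j.succ - p.val.2 j.castSucc)) *
      (revMeasure q c d (layerGap p.val (Fin.last N)) * h (layerGap p.val (Fin.last N))))

/-- Increment of a Bernoulli path. -/
def bitInc (u : Bool) : ℤ := if u then 1 else 0

/-- The steps which keep a gap `x` nonnegative. -/
def allowedSteps (x : ℤ) : Set (Bool × Bool) := {s | 0 ≤ x + bitInc s.1 - bitInc s.2}

/-- The admissible range of the bulk parameters. -/
structure Admissible (q c d : ℝ) : Prop where
  hc1 : -1 < c
  hc2 : c ≤ 0
  hd1 : -1 < d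
  hd2 : d ≤ 0
  hq0 : 0 ≤ q
  hq1 : q < 1

namespace Admissible

variable {q c d : ℝ}

lemma mul_nonneg (H : Admissible q c d) : 0 ≤ c * d :=
  mul_nonneg_of_nonpos_of_nonpos H.hc2 H.hd2

lemma mul_lt_one (H : Admissible q c d) : c * d < 1 := by
  have := H.hc1; have := H.hc2; have := H.hd1; have := H.hd2
  nlinarith

lemma pow_nonneg (H : Admissible q c d) (n : ℕ) : 0 ≤ q ^ n := _root_.pow_nonneg H.hq0 n

lemma pow_le_one (H : Admissible q c d) (n : ℕ) : q ^ n ≤ 1 := pow_le_one₀ H.hq0 H.hq1.le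

lemma up_nonneg (H : Admissible q c d) (n : ℕ) : 0 ≤ 1 - q ^ n := by
  linarith [H.pow_le_one n]

lemma up_pos (H : Admissible q c d) (n : ℕ) : 0 < 1 - q ^ (n + 1) := by
  have : q ^ (n + 1) < 1 := pow_lt_one₀ H.hq0 H.hq1 n.succ_ne_zero
  linarith

lemma flat_pos (H : Admissible q c d) (n : ℕ) : 0 < 1 + c * q ^ n := by
  have := H.hc1; have := H.hc2; have := H.pow_nonneg n; have := H.pow_le_one n
  nlinarith

lemma flat_pos' (H : Admissible q c d) (n : ℕ) : 0 < 1 + d * q ^ n := by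
  have := H.hd1; have := H.hd2; have := H.pow_nonneg n; have := H.pow_le_one n
  nlinarith

lemma down_pos (H : Admissible q c d) (n : ℕ) : 0 < 1 - c * d * q ^ n := by
  have := H.mul_nonneg; have := H.mul_lt_one; have := H.pow_nonneg n; have := H.pow_le_one n
  nlinarith

lemma qPoch_pos (H : Admissible q c d) (n : ℕ) : 0 < qPoch (c * d) q n :=
  Finset.prod_pos fun j _ => H.down_pos j

lemma qPoch_self_pos (H : Admissible q c d) (n : ℕ) : 0 < qPoch q q n :=
  Finset.prod_pos fun j _ => by simpa [pow_succ'] using H.up_pos j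

lemma revMeasure_pos (H : Admissible q c d) (n : ℕ) : 0 < revMeasure q c d n :=
  div_pos (H.qPoch_pos n) (H.qPoch_self_pos n)

/-- Detailed balance. -/
lemma revMeasure_succ (H : Admissible q c d) (n : ℕ) :
    (1 - q ^ (n + 1)) * revMeasure q c d (n + 1)
      = (1 - c * d * q ^ n) * revMeasure q c d n := by
  have h1 := (H.qPoch_self_pos n).ne'
  have h2 := (H.up_pos n).ne'
  have e1 : qPoch (c * d) q (n + 1) = qPoch (c * d) q n * (1 - c * d * q ^ n) :=
    Finset.prod_range_succ _ _
  have e2 : qPoch q q (n + 1) = qPoch q q n * (1 - q ^ (n + 1)) := by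
    rw [pow_succ']; exact Finset.prod_range_succ _ _
  rw [revMeasure, revMeasure, e1, e2]
  field_simp

lemma stepOp_nonneg (H : Admissible q c d) {h : ℕ → ℝ} (hh : ∀ n, 0 ≤ h n) (n : ℕ) :
    0 ≤ stepOp q c d h n := by
  have := H.up_nonneg n; have := H.flat_pos n; have := H.flat_pos' n; have := H.down_pos n
  have := hh n; have := hh (n - 1); have := hh (n + 1)
  unfold stepOp; positivity

lemma stepOp_mono (H : Admissible q c d) {g h : ℕ → ℝ} (hh : ∀ n, g n ≤ h n) (n : ℕ) :
    stepOp q c d g n ≤ stepOp q c d h n := by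
  have := H.up_nonneg n; have := H.flat_pos n; have := H.flat_pos' n; have := H.down_pos n
  have := hh n; have := hh (n - 1); have := hh (n + 1)
  unfold stepOp; gcongr

lemma iterate_stepOp_nonneg (H : Admissible q c d) {h : ℕ → ℝ} (hh : ∀ n, 0 ≤ h n) (N n : ℕ) :
    0 ≤ (stepOp q c d)^[N] h n := by
  induction N generalizing n with
  | zero => exact hh n
  | succ N ih => rw [Function.iterate_succ_apply']; exact H.stepOp_nonneg ih n

lemma Wfac_nonneg (H : Admissible q c d) (x u v : ℤ) : 0 ≤ Wfac q c d x u v := by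
  unfold Wfac
  split_ifs
  exacts [H.up_nonneg _, (H.flat_pos' _).le, (H.flat_pos _).le, (H.down_pos _).le]

lemma tsum_stepOp_comm (H : Admissible q c d) {f g : ℕ → ℝ} (hf : ∀ n, 0 ≤ f n)
    (hg : ∀ n, 0 ≤ g n) :
    ∑' n, ENNReal.ofReal (f n * (revMeasure q c d n * stepOp q c d g n))
      = ∑' n, ENNReal.ofReal (stepOp q c d f n * (revMeasure q c d n * g n)) := by
  have key : ∀ f g : ℕ → ℝ, (∀ n, 0 ≤ f n) → (∀ n, 0 ≤ g n) →
      ∑' n, ENNReal.ofReal (f n * (revMeasure q c d n * stepOp q c d g n))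
      = ∑' n, ENNReal.ofReal
          (f (n + 1) * ((1 - c * d * q ^ n) * revMeasure q c d n) * g n)
        + ∑' n, ENNReal.ofReal
          (f n * revMeasure q c d n * ((1 + c * q ^ n) + (1 + d * q ^ n)) * g n)
        + ∑' n, ENNReal.ofReal
          (f n * ((1 - c * d * q ^ n) * revMeasure q c d n) * g (n + 1)) := by
    intro f g hf hg
    have e : ∀ n, ENNReal.ofReal (f n * (revMeasure q c d n * stepOp q c d g n))
        = ENNReal.ofReal (f n * ((1 - q ^ n) * revMeasure q c d n) * g (n - 1))
        + ENNReal.ofReal (f n * revMeasure q c d n * ((1 + c * q ^ n) + (1 + d * q ^ n)) * g n)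
        + ENNReal.ofReal (f n * ((1 - c * d * q ^ n) * revMeasure q c d n) * g (n + 1)) := by
      intro n
      have := H.up_nonneg n; have := H.flat_pos n; have := H.flat_pos' n
      have := H.down_pos n; have := H.revMeasure_pos n
      have := hf n; have := hg n; have := hg (n - 1); have := hg (n + 1)
      rw [← ENNReal.ofReal_add (by positivity) (by positivity),
        ← ENNReal.ofReal_add (by positivity) (by positivity), stepOp]
      congr 1
      ring
    rw [tsum_congr e, ENNReal.tsum_add, ENNReal.tsum_add]
    congr 2
    rw [tsum_eq_zero_add' ENNReal.summable]
    simp [H.revMeasure_succ]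
  have e' : ∀ n, stepOp q c d f n * (revMeasure q c d n * g n)
      = g n * (revMeasure q c d n * stepOp q c d f n) := fun n => by ring
  simp only [e']
  rw [key f g hf hg, key g f hg hf]
  conv_lhs => rw [add_comm, add_comm (tsum _) (tsum _), ← add_assoc]
  congr 1
  · congr 1 <;> exact tsum_congr fun n => by congr 1; ring
  · exact tsum_congr fun n => by congr 1; ring

lemma tsum_iterate_stepOp_comm (H : Admissible q c d) (N : ℕ) {f g : ℕ → ℝ} (hf : ∀ n, 0 ≤ f n)
    (hg : ∀ n, 0 ≤ g n) :
    ∑' n, ENNReal.ofReal (f n * (revMeasure q c d n * (stepOp q c d)^[N] g n))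
      = ∑' n, ENNReal.ofReal ((stepOp q c d)^[N] f n * (revMeasure q c d n * g n)) := by
  induction N generalizing f with
  | zero => rfl
  | succ N ih =>
    simp only [Function.iterate_succ_apply' _ N g]
    rw [H.tsum_stepOp_comm hf (H.iterate_stepOp_nonneg hg N), ih (H.stepOp_nonneg hf)]
    simp only [Function.iterate_succ_apply]

/-- Sum over the last step of a configuration. -/
lemma tsum_allowedSteps (H : Admissible q c d) {A : ℝ} (hA : 0 ≤ A) {h : ℕ → ℝ}
    (hh : ∀ n, 0 ≤ h n) (n : ℕ) :
    ∑' s : allowedSteps n, ENNReal.ofReal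
      (A * Wfac q c d (n + bitInc s.1.1 - bitInc s.1.2) (bitInc s.1.1) (bitInc s.1.2) *
        (revMeasure q c d (n + bitInc s.1.1 - bitInc s.1.2).toNat *
          h (n + bitInc s.1.1 - bitInc s.1.2).toNat))
      = ENNReal.ofReal (A * (revMeasure q c d n * stepOp q c d h n)) := by
  rw [tsum_subtype (allowedSteps n) (fun s : Bool × Bool => ENNReal.ofReal
      (A * Wfac q c d (n + bitInc s.1 - bitInc s.2) (bitInc s.1) (bitInc s.2) *
        (revMeasure q c d (n + bitInc s.1 - bitInc s.2).toNat *
          h (n + bitInc s.1 - bitInc s.2).toNat))), tsum_fintype, Fintype.sum_prod_type]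
  have hp := fun n => (H.revMeasure_pos n).le
  have h1 : ((n : ℤ) + 1).toNat = n + 1 := by omega
  have h2 := H.revMeasure_succ n
  have := H.flat_pos n; have := H.flat_pos' n; have := H.down_pos n; have := H.up_pos n
  have := hp n; have := hp (n + 1); have := hh n; have := hh (n + 1)
  rcases n with _ | m
  · simp [Set.indicator_apply, allowedSteps, bitInc, Wfac] at *
    rw [← ENNReal.ofReal_add (by positivity) (by positivity),
      ← ENNReal.ofReal_add (by positivity) (by positivity), stepOp]
    congr 1
    simp
    linear_combination A * h 1 * h2
  · have h3 := H.revMeasure_succ m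
    have := hp m; have := hh m; have := H.down_pos m
    have h4 : (0 : ℤ) ≤ (m : ℤ) + 1 := by omega
    have h5 : (0 : ℤ) ≤ (m : ℤ) + 1 + 1 := by omega
    simp [Set.indicator_apply, allowedSteps, bitInc, Wfac, h4, h5] at *
    have h6 : ((m : ℤ) + 1).toNat = m + 1 := by omega
    simp only [h6, h1] at *
    rw [← ENNReal.ofReal_add (by positivity) (by positivity),
      ← ENNReal.ofReal_add (by positivity) (by positivity),
      ← ENNReal.ofReal_add (by positivity) (by positivity), stepOp]
    congr 1
    simp
    linear_combination A * h (m + 2) * h2 - A * h m * h3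

end Admissible

lemma bitInc_eq (u : Bool) : bitInc u = 0 ∨ bitInc u = 1 := by cases u <;> simp [bitInc]

lemma bitInc_injective : Function.Injective bitInc := by
  intro u v h
  cases u <;> cases v <;> simp [bitInc] at h ⊢

/-- Extension of a path by one step. -/
def extendPath {N : ℕ} (L : Fin (N + 1) → ℤ) (u : Bool) : Fin (N + 1 + 1) → ℤ :=
  Fin.snoc (α := fun _ => ℤ) L (L (Fin.last N) + bitInc u)

@[simp] lemma extendPath_castSucc {N : ℕ} (L : Fin (N + 1) → ℤ) (u : Bool) (j : Fin (N + 1)) :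
    extendPath L u j.castSucc = L j := by
  simp [extendPath]

@[simp] lemma extendPath_last {N : ℕ} (L : Fin (N + 1) → ℤ) (u : Bool) :
    extendPath L u (Fin.last (N + 1)) = L (Fin.last N) + bitInc u := by
  simp [extendPath]

lemma extendPath_zero {N : ℕ} (L : Fin (N + 1) → ℤ) (u : Bool) :
    extendPath L u 0 = L 0 := by
  rw [← Fin.castSucc_zero, extendPath_castSucc]

lemma isBPath_extendPath {N : ℕ} {L : Fin (N + 1) → ℤ} (hL : IsBPath N L) (u : Bool) :
    IsBPath (N + 1) (extendPath L u) := by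
  intro j
  induction j using Fin.lastCases with
  | last => rcases bitInc_eq u with h | h <;> simp [Fin.succ_last, h]
  | cast i => simpa only [Fin.succ_castSucc, extendPath_castSucc] using hL i

lemma exists_eq_extendPath {N : ℕ} {L : Fin (N + 1 + 1) → ℤ} (hL : IsBPath (N + 1) L) :
    ∃ u, IsBPath N (fun j => L j.castSucc) ∧ L = extendPath (fun j => L j.castSucc) u := by
  obtain ⟨u, hu⟩ : ∃ u, L (Fin.last (N + 1)) = L (Fin.last N).castSucc + bitInc u := by
    rcases hL (Fin.last N) with h | h
    · exact ⟨false, by simpa [Fin.succ_last, bitInc] using h⟩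
    · exact ⟨true, by simpa [Fin.succ_last, bitInc] using h⟩
  refine ⟨u, fun j => ?_, ?_⟩
  · simpa only [Fin.succ_castSucc] using hL j.castSucc
  · funext j
    induction j using Fin.lastCases with
    | last => rw [extendPath_last, hu]
    | cast i => rw [extendPath_castSucc]

/-- Extension of a two-layer configuration by one step. -/
def extendTL {N : ℕ}
    (x : Σ p : TLset N, allowedSteps (p.val.1 (Fin.last N) - p.val.2 (Fin.last N))) :
    TLset (N + 1) :=
  ⟨(extendPath x.1.val.1 x.2.val.1, extendPath x.1.val.2 x.2.val.2), by
    obtain ⟨⟨⟨L, M⟩, h0, h1, h2, h3⟩, ⟨u, v⟩, h4⟩ := x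
    refine ⟨(extendPath_zero L u).trans h0, fun j => ?_, isBPath_extendPath h2 u,
      isBPath_extendPath h3 v⟩
    induction j using Fin.lastCases with
    | last =>
      simp only [allowedSteps, Set.mem_ofPred_eq, extendPath_last] at h4 ⊢
      omega
    | cast i => simpa only [extendPath_castSucc] using h1 i⟩

lemma extendTL_bijective (N : ℕ) : Function.Bijective (extendTL (N := N)) := by
  constructor
  · rintro ⟨⟨⟨L, M⟩, hp⟩, ⟨u, v⟩, h4⟩ ⟨⟨⟨L', M'⟩, hp'⟩, ⟨u', v'⟩, h4'⟩ h
    have h1 := congrArg (fun p => p.val.1) h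
    have h2 := congrArg (fun p => p.val.2) h
    simp only [extendTL] at h1 h2
    have e1 : L = L' := funext fun j => by simpa using congrFun h1 j.castSucc
    have e2 : M = M' := funext fun j => by simpa using congrFun h2 j.castSucc
    subst e1 e2
    have e3 : u = u' := bitInc_injective (by simpa using congrFun h1 (Fin.last _))
    have e4 : v = v' := bitInc_injective (by simpa using congrFun h2 (Fin.last _))
    subst e3 e4
    rfl
  · rintro ⟨⟨L, M⟩, h0, h1, h2, h3⟩
    obtain ⟨u, hL, eL⟩ := exists_eq_extendPath h2
    obtain ⟨v, hM, eM⟩ := exists_eq_extendPath h3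
    refine ⟨⟨⟨(fun j => L j.castSucc, fun j => M j.castSucc), ?_, fun j => h1 j.castSucc,
      hL, hM⟩, ⟨(u, v), ?_⟩⟩, ?_⟩
    · simpa using h0
    · have := h1 (Fin.last _)
      have e1 := congrFun eL (Fin.last _)
      have e2 := congrFun eM (Fin.last _)
      simp only [extendPath_last] at this e1 e2
      simp only [allowedSteps, Set.mem_ofPred_eq]
      omega
    · exact Subtype.ext (Prod.ext eL.symm eM.symm)

lemma pathSum_succ {q c d : ℝ} (H : Admissible q c d) (N : ℕ) {f h : ℕ → ℝ} (hf : ∀ n, 0 ≤ f n)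
    (hh : ∀ n, 0 ≤ h n) :
    pathSum q c d (N + 1) f h = pathSum q c d N f (stepOp q c d h) := by
  unfold pathSum
  rw [← (Equiv.ofBijective _ (extendTL_bijective N)).tsum_eq, ENNReal.tsum_sigma']
  refine tsum_congr fun p => ?_
  obtain ⟨n, hn⟩ := Int.eq_ofNat_of_zero_le (sub_nonneg.2 (p.2.2.1 (Fin.last N)))
  have hA : 0 ≤ f (layerGap p.val 0) *
      ∏ j : Fin N, Wfac q c d (p.val.1 j.succ - p.val.2 j.succ)
        (p.val.1 j.succ - p.val.1 j.castSucc) (p.val.2 j.succ - p.val.2 j.castSucc) :=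
    mul_nonneg (hf _) (Finset.prod_nonneg fun j _ => H.Wfac_nonneg _ _ _)
  have key := H.tsum_allowedSteps hA hh n
  have hg : layerGap p.val (Fin.last N) = n := by simp [layerGap, hn]
  rw [← hn] at key
  rw [hg, ← key]
  refine tsum_congr fun s => ?_
  have e1 : p.val.1 (Fin.last N) + bitInc s.1.1 - (p.val.2 (Fin.last N) + bitInc s.1.2)
      = p.val.1 (Fin.last N) - p.val.2 (Fin.last N) + bitInc s.1.1 - bitInc s.1.2 := by ring
  simp only [Equiv.ofBijective_apply, extendTL, layerGap, extendPath_zero, extendPath_last,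
    Fin.prod_univ_castSucc, Fin.succ_castSucc, extendPath_castSucc, Fin.succ_last, e1,
    add_sub_cancel_left, mul_assoc]

lemma pathSum_zero (q c d : ℝ) (f h : ℕ → ℝ) :
    pathSum q c d 0 f h = ∑' n, ENNReal.ofReal (f n * (revMeasure q c d n * h n)) := by
  let e : ℕ → TLset 0 := fun n => ⟨(fun _ => 0, fun _ => -n), rfl, fun _ => by simp,
    fun j => j.elim0, fun j => j.elim0⟩
  have he : Function.Bijective e := by
    constructor
    · intro m n h
      have := congrFun (congrArg (fun p => p.val.2) h) 0
      simpa [e] using this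
    · rintro ⟨⟨L, M⟩, h0, h1, h2, h3⟩
      have := h1 0
      simp only at this h0
      refine ⟨(L 0 - M 0).toNat, Subtype.ext (Prod.ext (funext fun j => ?_) (funext fun j => ?_))⟩
      · rw [Fin.fin_one_eq_zero j]; exact h0.symm
      · rw [Fin.fin_one_eq_zero j]; simp only [e]; omega
  rw [pathSum, ← (Equiv.ofBijective e he).tsum_eq]
  simp [e, layerGap]

lemma pathSum_eq {q c d : ℝ} (H : Admissible q c d) (N : ℕ) {f h : ℕ → ℝ} (hf : ∀ n, 0 ≤ f n)
    (hh : ∀ n, 0 ≤ h n) :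
    pathSum q c d N f h
      = ∑' n, ENNReal.ofReal (f n * (revMeasure q c d n * (stepOp q c d)^[N] h n)) := by
  induction N generalizing h with
  | zero => exact pathSum_zero q c d f h
  | succ N ih =>
    rw [pathSum_succ H N hf hh, ih (H.stepOp_nonneg hh)]
    simp only [Function.iterate_succ_apply]

lemma Zconst_eq_toReal {q a b c d : ℝ} (H : Admissible q c d) (ha : 0 ≤ a) (hb : 0 ≤ b) (N : ℕ) :
    Zconst N q a b c d = (pathSum q c d N (fun n => a ^ n) (fun n => b ^ n)).toReal := by
  rw [pathSum, ENNReal.tsum_toReal_eq fun _ => ENNReal.ofReal_ne_top]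
  refine tsum_congr fun p => ?_
  rw [ENNReal.toReal_ofReal]
  · simp only [twt, layerGap, revMeasure]; ring
  · have := H.revMeasure_pos (layerGap p.val (Fin.last N))
    have := Finset.prod_nonneg fun j (_ : j ∈ (Finset.univ : Finset (Fin N))) =>
      H.Wfac_nonneg (p.val.1 j.succ - p.val.2 j.succ)
      (p.val.1 j.succ - p.val.1 j.castSucc) (p.val.2 j.succ - p.val.2 j.castSucc)
    positivity

lemma Zconst_eq_tsum {q a b c d : ℝ} (H : Admissible q c d) (ha : 0 ≤ a) (hb : 0 ≤ b) (N : ℕ) :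
    Zconst N q a b c d
      = ∑' n, a ^ n * (revMeasure q c d n * (stepOp q c d)^[N] (fun n => b ^ n) n) := by
  rw [Zconst_eq_toReal H ha hb, pathSum_eq H N (fun n => by positivity) (fun n => by positivity),
    ENNReal.tsum_toReal_eq fun _ => ENNReal.ofReal_ne_top]
  refine tsum_congr fun n => ENNReal.toReal_ofReal ?_
  have := (H.revMeasure_pos n).le
  have := H.iterate_stepOp_nonneg (h := fun n => b ^ n) (fun n => by positivity) N n
  positivity

lemma Zconst_comm {q a b c d : ℝ} (H : Admissible q c d) (ha : 0 ≤ a) (hb : 0 ≤ b) (N : ℕ) :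
    Zconst N q a b c d = Zconst N q b a c d := by
  have hf : ∀ n : ℕ, 0 ≤ a ^ n := fun n => by positivity
  have hg : ∀ n : ℕ, 0 ≤ b ^ n := fun n => by positivity
  rw [Zconst_eq_toReal H ha hb, Zconst_eq_toReal H hb ha, pathSum_eq H N hf hg,
    pathSum_eq H N hg hf, H.tsum_iterate_stepOp_comm N hf hg]
  congr 1
  exact tsum_congr fun n => by congr 1; ring

lemma tendsto_inv_mul_log {Z : ℕ → ℝ} {μ C : ℝ} (hμ : 0 < μ) (hC : 0 < C)
    (hup : ∀ N, Z N ≤ C * μ ^ N)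
    (hlow : ∀ ν, 0 < ν → ν < μ → ∃ k > 0, ∃ N₀, ∀ N ≥ N₀, k * ν ^ N ≤ Z N) :
    Filter.Tendsto (fun N : ℕ => (N : ℝ)⁻¹ * Real.log (Z N)) Filter.atTop
      (nhds (Real.log μ)) := by
  have hlim : ∀ k x : ℝ, Filter.Tendsto (fun N : ℕ => (N : ℝ)⁻¹ * k + x) Filter.atTop (nhds x) := by
    intro k x
    simpa using (tendsto_inv_atTop_nhds_zero_nat (𝕜 := ℝ)).mul_const k |>.add_const x
  have hlog : ∀ k ν : ℝ, 0 < k → 0 < ν → ∀ N : ℕ, N ≠ 0 →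
      (N : ℝ)⁻¹ * Real.log (k * ν ^ N) = (N : ℝ)⁻¹ * Real.log k + Real.log ν := by
    intro k ν hk hν N hN
    have : (N : ℝ) ≠ 0 := Nat.cast_ne_zero.2 hN
    rw [Real.log_mul hk.ne' (pow_pos hν N).ne', Real.log_pow]
    field_simp
  refine tendsto_order.2 ⟨fun x hx => ?_, fun x hx => ?_⟩
  · obtain ⟨y, hxy, hy⟩ := exists_between hx
    obtain ⟨k, hk, N₀, hN₀⟩ := hlow (Real.exp y) (Real.exp_pos y)
      ((Real.lt_log_iff_exp_lt hμ).1 hy)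
    filter_upwards [(tendsto_order.1 (hlim (Real.log k) y)).1 x hxy, Filter.eventually_ge_atTop N₀,
      Filter.eventually_ne_atTop 0] with N h1 h2 h3
    refine h1.trans_le ?_
    have := hlog k _ hk (Real.exp_pos y) N h3
    rw [Real.log_exp] at this
    rw [← this]
    gcongr
    exact hN₀ N h2
  · obtain ⟨k, hk, N₀, hN₀⟩ := hlow (μ / 2) (by linarith) (by linarith)
    filter_upwards [(tendsto_order.1 (hlim (Real.log C) (Real.log μ))).2 x hx,
      Filter.eventually_ge_atTop N₀, Filter.eventually_ne_atTop 0] with N h1 h2 h3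
    refine lt_of_le_of_lt ?_ h1
    rw [← hlog C μ hC hμ N h3]
    have : 0 < Z N := lt_of_lt_of_le (by positivity) (hN₀ N h2)
    gcongr
    exact hup N

namespace Admissible

variable {q c d : ℝ}

lemma summable_revMeasure_mul_pow (H : Admissible q c d) {x : ℝ} (hx0 : 0 ≤ x) (hx1 : x < 1) :
    Summable fun n => revMeasure q c d n * x ^ n := by
  obtain ⟨t, hxt, ht1⟩ := exists_between hx1
  have ht0 : 0 < t := hx0.trans_lt hxt
  have hsum : Summable fun n => revMeasure q c d n * t ^ n := by
    refine summable_of_ratio_test_tendsto_lt_one ht1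
      (.of_forall fun n => (mul_pos (H.revMeasure_pos n) (pow_pos ht0 n)).ne') ?_
    have e : ∀ n, ‖revMeasure q c d (n + 1) * t ^ (n + 1)‖ / ‖revMeasure q c d n * t ^ n‖
        = (1 - c * d * q ^ n) / (1 - q ^ (n + 1)) * t := by
      intro n
      have h1 := H.revMeasure_pos n; have h2 := H.revMeasure_pos (n + 1)
      have h3 := H.revMeasure_succ n; have h4 := H.up_pos n
      rw [Real.norm_of_nonneg (by positivity), Real.norm_of_nonneg (by positivity),
        div_eq_iff (by positivity), div_mul_eq_mul_div, div_mul_eq_mul_div, eq_div_iff h4.ne']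
      linear_combination t ^ (n + 1) * h3
    simp only [e]
    have hq := tendsto_pow_atTop_nhds_zero_of_lt_one H.hq0 H.hq1
    have hq' := (Filter.tendsto_add_atTop_iff_nat 1).2 hq
    have := (((hq.const_mul (c * d)).const_sub 1).div (hq'.const_sub 1) (by norm_num)).mul_const t
    simpa using this
  refine hsum.of_nonneg_of_le (fun n => ?_) (fun n => ?_)
  · have := (H.revMeasure_pos n).le; positivity
  · have := (H.revMeasure_pos n).le; gcongr

lemma stepOp_pow_le (H : Admissible q c d) {s : ℝ} (hs : 1 ≤ s) (n : ℕ) :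
    stepOp q c d (fun n => s ^ n) n ≤ (s + 2 + s⁻¹) * s ^ n := by
  have hs0 : 0 < s := by linarith
  have hc := mul_nonneg_of_nonpos_of_nonpos (neg_nonpos.2 (H.pow_nonneg n)) H.hc2
  have hd := mul_nonneg_of_nonpos_of_nonpos (neg_nonpos.2 (H.pow_nonneg n)) H.hd2
  have hcd := _root_.mul_nonneg H.mul_nonneg (H.pow_nonneg n)
  have h2 : ((1 + c * q ^ n) + (1 + d * q ^ n)) * s ^ n ≤ 2 * s ^ n := by
    gcongr; linarith
  have h3 : (1 - c * d * q ^ n) * s ^ (n + 1) ≤ s ^ n * s := by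
    rw [pow_succ]; exact mul_le_of_le_one_left (by positivity) (by linarith)
  have h1 : (1 - q ^ n) * s ^ (n - 1) ≤ s⁻¹ * s ^ n := by
    rcases n with _ | m
    · simp [hs0.le]
    · have : s⁻¹ * s ^ (m + 1) = s ^ m := by
        rw [pow_succ', inv_mul_cancel_left₀ hs0.ne']
      rw [this]
      exact mul_le_of_le_one_left (by positivity) (by linarith [H.pow_nonneg (m + 1)])
  rw [stepOp]
  linarith

lemma iterate_stepOp_pow_le (H : Admissible q c d) {b s : ℝ} (hb : 0 ≤ b) (hbs : b ≤ s)
    (hs : 1 ≤ s) (N n : ℕ) :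
    (stepOp q c d)^[N] (fun n => b ^ n) n ≤ (s + 2 + s⁻¹) ^ N * s ^ n := by
  induction N generalizing n with
  | zero => simpa using pow_le_pow_left₀ hb hbs n
  | succ N ih =>
    rw [Function.iterate_succ_apply']
    have hs0 : 0 < s := by linarith
    have e : stepOp q c d (fun n => (s + 2 + s⁻¹) ^ N * s ^ n) n
        = (s + 2 + s⁻¹) ^ N * stepOp q c d (fun n => s ^ n) n := by
      simp only [stepOp]; ring
    refine (H.stepOp_mono ih n).trans ?_
    rw [e, pow_succ, mul_assoc]
    gcongr
    exact H.stepOp_pow_le hs n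

/-- A uniform lower bound for the nonzero entries of `stepOp`. -/
lemma exists_stepOp_ge (H : Admissible q c d) : ∃ κ > 0, ∀ h : ℕ → ℝ, (∀ n, 0 ≤ h n) → ∀ n,
    κ * h n ≤ stepOp q c d h n ∧ κ * h (n + 1) ≤ stepOp q c d h n ∧
      κ * h n ≤ stepOp q c d h (n + 1) := by
  have h1 := H.hc1
  have h2 := H.hq1
  refine ⟨min (min (1 - q) (1 + c)) (1 - c * d),
    lt_min (lt_min (by linarith) (by linarith)) (by linarith [H.mul_lt_one]), fun h hh n => ?_⟩
  set κ := min (min (1 - q) (1 + c)) (1 - c * d)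
  have k1 : κ ≤ 1 - q := (min_le_left _ _).trans (min_le_left _ _)
  have k2 : κ ≤ 1 + c := (min_le_left _ _).trans (min_le_right _ _)
  have k3 : κ ≤ 1 - c * d := min_le_right _ _
  have up : ∀ n, κ ≤ 1 - q ^ (n + 1) := fun n => by
    have : q ^ (n + 1) ≤ q := pow_le_of_le_one H.hq0 H.hq1.le n.succ_ne_zero
    linarith
  have flat : ∀ n, κ ≤ (1 + c * q ^ n) + (1 + d * q ^ n) := fun n => by
    have := H.flat_pos' n
    have : c ≤ c * q ^ n := by
      nlinarith [H.hc2, H.pow_le_one n]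
    linarith
  have down : ∀ n, κ ≤ 1 - c * d * q ^ n := fun n => by
    have := mul_le_of_le_one_right H.mul_nonneg (H.pow_le_one n)
    linarith
  have pu := fun n m => _root_.mul_nonneg (H.up_nonneg n) (hh m)
  have pf := fun n m => _root_.mul_nonneg (add_pos (H.flat_pos n) (H.flat_pos' n)).le (hh m)
  have pd := fun n m => _root_.mul_nonneg (H.down_pos n).le (hh m)
  have a1 := mul_le_mul_of_nonneg_right (flat n) (hh n)
  have a2 := mul_le_mul_of_nonneg_right (down n) (hh (n + 1))
  have a3 := mul_le_mul_of_nonneg_right (up n) (hh n)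
  simp only [stepOp, Nat.add_sub_cancel]
  refine ⟨?_, ?_, ?_⟩
  · linarith [pu n (n - 1), pd n (n + 1)]
  · linarith [pu n (n - 1), pf n n]
  · linarith [pf (n + 1) (n + 1), pd (n + 1) (n + 1 + 1)]

/-- Iterates of `stepOp` dominate positive subsolutions of the free lazy walk, placed far from
the origin. -/
lemma iterate_stepOp_ge_subsolution (H : Admissible q c d) {w : ℕ → ℝ} {ρ r : ℝ}
    (hr : 0 ≤ r) (h0 : ρ * w 0 ≤ 2 * w 0 + w 1)
    (h1 : ∀ k, ρ * w (k + 1) ≤ w k + 2 * w (k + 1) + w (k + 2))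
    {M : ℕ} (hM : ∀ n ≥ M, q ^ n ≤ 1 - r) {g : ℕ → ℝ} (hg : ∀ n, 0 ≤ g n) {C : ℝ} (hC : 0 ≤ C)
    (hw : ∀ k, C * w k ≤ g (M + k)) (hρ : 0 ≤ ρ) (N k : ℕ) :
    C * (r * ρ) ^ N * w k ≤ (stepOp q c d)^[N] g (M + k) := by
  induction N generalizing k with
  | zero => simpa using hw k
  | succ N ih =>
    rw [Function.iterate_succ_apply']
    have hG := H.iterate_stepOp_nonneg hg N
    set G := (stepOp q c d)^[N] g
    have hCN : 0 ≤ C * (r * ρ) ^ N * r := by positivity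
    have up : ∀ n ≥ M, r * G (n - 1) ≤ (1 - q ^ n) * G (n - 1) := fun n hn =>
      mul_le_mul_of_nonneg_right (by linarith [hM n hn]) (hG _)
    have flat : ∀ n ≥ M, r * (2 * G n) ≤ ((1 + c * q ^ n) + (1 + d * q ^ n)) * G n := by
      intro n hn
      have := hM n hn; have := H.pow_nonneg n; have := H.hc1; have := H.hd1
      have h2 : 2 * r ≤ (1 + c * q ^ n) + (1 + d * q ^ n) := by nlinarith
      linarith [mul_le_mul_of_nonneg_right h2 (hG n)]
    have down : ∀ n ≥ M, r * G (n + 1) ≤ (1 - c * d * q ^ n) * G (n + 1) := by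
      intro n hn
      have := hM n hn; have := H.pow_nonneg n; have := H.mul_lt_one
      exact mul_le_mul_of_nonneg_right (by nlinarith) (hG _)
    rw [stepOp]
    rcases k with _ | k
    · have e0 := ih 0
      have e1 := ih 1
      rw [add_zero] at e0 ⊢
      have := flat M le_rfl; have := down M le_rfl
      have := _root_.mul_nonneg (H.up_nonneg M) (hG (M - 1))
      have := mul_le_mul_of_nonneg_left h0 hCN
      have := mul_le_mul_of_nonneg_left e0 hr
      have := mul_le_mul_of_nonneg_left e1 hr
      rw [pow_succ]
      linarith
    · have e0 := ih k
      have e1 := ih (k + 1)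
      have e2 := ih (k + 2)
      have hn : M + (k + 1) ≥ M := by omega
      have f1 := up _ hn; have := flat _ hn; have := down _ hn
      have e3 : M + (k + 1) - 1 = M + k := by omega
      rw [e3] at f1 ⊢
      have := mul_le_mul_of_nonneg_left (h1 k) hCN
      have := mul_le_mul_of_nonneg_left e0 hr
      have := mul_le_mul_of_nonneg_left e1 hr
      have := mul_le_mul_of_nonneg_left e2 hr
      rw [show M + (k + 2) = M + (k + 1) + 1 by omega] at *
      rw [pow_succ]
      linarith

lemma iterate_stepOp_zero_ge (H : Admissible q c d) {w : ℕ → ℝ} {ρ ν : ℝ} (hν : 0 < ν)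
    (hνρ : ν < ρ) (hw0 : 0 < w 0) (h0 : ρ * w 0 ≤ 2 * w 0 + w 1)
    (h1 : ∀ k, ρ * w (k + 1) ≤ w k + 2 * w (k + 1) + w (k + 2))
    {g : ℕ → ℝ} (hg : ∀ n, 0 ≤ g n)
    (hw : ∀ M, ∃ K, ∃ C > 0, ∀ k, C * w k ≤ (stepOp q c d)^[K] g (M + k)) :
    ∃ k > 0, ∃ N₀, ∀ N ≥ N₀, k * ν ^ N ≤ (stepOp q c d)^[N] g 0 := by
  obtain ⟨κ, hκ, hstep⟩ := H.exists_stepOp_ge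
  have descend : ∀ M n, ∀ h : ℕ → ℝ, (∀ n, 0 ≤ h n) →
      κ ^ M * h (n + M) ≤ (stepOp q c d)^[M] h n := by
    intro M n
    induction M with
    | zero => intro h _; simp
    | succ M ih =>
      intro h hh
      refine le_trans ?_ (ih _ (H.stepOp_nonneg hh))
      rw [pow_succ, mul_assoc]
      gcongr
      exact (hstep h hh (n + M)).2.1
  have hρ : 0 < ρ := hν.trans hνρ
  have hr1 : ν / ρ < 1 := (div_lt_one hρ).2 hνρ
  obtain ⟨M, hM⟩ := Filter.eventually_atTop.1 <|
    (tendsto_pow_atTop_nhds_zero_of_lt_one H.hq0 H.hq1).eventually_le_const (sub_pos.2 hr1)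
  obtain ⟨K, C, hC, hCw⟩ := hw M
  refine ⟨κ ^ M * (C * w 0) / ν ^ (M + K), by positivity, M + K, fun N hN => ?_⟩
  obtain ⟨L, rfl⟩ := Nat.exists_eq_add_of_le hN
  have hgK := H.iterate_stepOp_nonneg hg K
  have e1 := H.iterate_stepOp_ge_subsolution (r := ν / ρ) (by positivity) h0 h1 hM hgK
    hC.le hCw hρ.le L 0
  have e2 := descend M 0 _ (H.iterate_stepOp_nonneg hgK L)
  rw [div_mul_cancel₀ _ hρ.ne', add_zero] at e1
  rw [zero_add] at e2
  rw [show M + K + L = M + (L + K) by omega, Function.iterate_add_apply,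
    Function.iterate_add_apply]
  refine le_trans (le_of_eq ?_) ((mul_le_mul_of_nonneg_left e1 (by positivity)).trans e2)
  rw [show M + (L + K) = (M + K) + L by omega, pow_add ν (M + K) L]
  field_simp

lemma iterate_stepOp_zero_ge_of_one_lt (H : Admissible q c d) {b ν : ℝ} (hb : 1 < b)
    (hν : 0 < ν) (hνb : ν < b + 2 + b⁻¹) :
    ∃ k > 0, ∃ N₀, ∀ N ≥ N₀, k * ν ^ N ≤ (stepOp q c d)^[N] (fun n => b ^ n) 0 := by
  have hb0 : 0 < b := by linarith
  have hb1 : b⁻¹ < 1 := inv_lt_one_of_one_lt₀ hb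
  have hbb : b * b⁻¹ = 1 := mul_inv_cancel₀ hb0.ne'
  refine H.iterate_stepOp_zero_ge (w := fun k => b ^ (k + 1) - b⁻¹ ^ (k + 1)) hν hνb ?_ ?_ ?_
    (fun n => by positivity) fun M => ⟨0, b⁻¹, by positivity, fun k => ?_⟩
  · simp only [zero_add, pow_one]; linarith
  · simp only [zero_add, pow_one]; nlinarith
  · intro k
    apply le_of_eq
    simp only [pow_succ]
    linear_combination (b ^ k * b - b⁻¹ ^ k * b⁻¹) * hbb
  · simp only [Function.iterate_zero, id]
    have h1 : b⁻¹ * b ^ (k + 1) = b ^ k := by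
      rw [pow_succ', inv_mul_cancel_left₀ hb0.ne']
    have h2 : b ^ k ≤ b ^ (M + k) := pow_le_pow_right₀ hb.le (by omega)
    have h3 : 0 ≤ b⁻¹ * b⁻¹ ^ (k + 1) := by positivity
    linarith

lemma iterate_stepOp_zero_ge_of_lt_four (H : Admissible q c d) {b ν : ℝ} (hb : 0 ≤ b)
    (hν : 0 < ν) (hν4 : ν < 4) :
    ∃ k > 0, ∃ N₀, ∀ N ≥ N₀, k * ν ^ N ≤ (stepOp q c d)^[N] (fun n => b ^ n) 0 := by
  obtain ⟨L, hL1, hL⟩ : ∃ L : ℕ, 1 ≤ L ∧ ν < 2 + 2 * Real.cos (Real.pi / (L + 1)) := by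
    have h1 : Filter.Tendsto (fun L : ℕ => Real.pi / ((L : ℝ) + 1)) Filter.atTop (nhds 0) := by
      simpa [div_eq_mul_inv] using
        (tendsto_one_div_add_atTop_nhds_zero_nat (𝕜 := ℝ)).const_mul Real.pi
    have h2 := ((Real.continuous_cos.tendsto 0).comp h1).const_mul 2 |>.const_add 2
    rw [Real.cos_zero] at h2
    obtain ⟨L, hL, hL'⟩ := ((h2.eventually_const_lt (by linarith : ν < 2 + 2 * 1)).and
      (Filter.eventually_ge_atTop 1)).exists
    exact ⟨L, hL', hL⟩
  set θ := Real.pi / ((L : ℝ) + 1) with hθ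
  have hθL : θ * (L + 1) = Real.pi := by rw [hθ]; field_simp
  have hθ0 : 0 < θ := by positivity
  have hpos : ∀ k : ℕ, k ≤ L + 1 → 0 ≤ Real.sin (θ * k) := by
    intro k hk
    refine Real.sin_nonneg_of_nonneg_of_le_pi (by positivity) ?_
    rw [← hθL]
    gcongr
    exact_mod_cast hk
  have hlt : ∀ k : ℕ, 0 < k → k ≤ L → 0 < Real.sin (θ * k) := by
    intro k hk0 hk
    have : (0 : ℝ) < k := by exact_mod_cast hk0
    refine Real.sin_pos_of_pos_of_lt_pi (by positivity) ?_
    rw [← hθL]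
    gcongr
    exact_mod_cast Nat.lt_succ_of_le hk
  have hadd : ∀ x, Real.sin (θ * x) + 2 * Real.sin (θ * (x + 1)) + Real.sin (θ * (x + 2))
      = (2 + 2 * Real.cos θ) * Real.sin (θ * (x + 1)) := by
    intro x
    rw [show θ * x = θ * (x + 1) - θ by ring, show θ * (x + 2) = θ * (x + 1) + θ by ring,
      Real.sin_sub, Real.sin_add]
    ring
  set w : ℕ → ℝ := fun k => if k + 1 ≤ L then Real.sin (θ * (k + 1 : ℕ)) else 0 with hw
  have hw_nonneg : ∀ k, 0 ≤ w k := by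
    intro k
    simp only [hw]
    split_ifs with h
    exacts [hpos _ (by omega), le_rfl]
  have hw_eq : ∀ k, k ≤ L → w k = Real.sin (θ * (k + 1)) := by
    intro k hk
    simp only [hw]
    split_ifs with h
    · push_cast; rfl
    · rw [show k = L by omega, hθL, Real.sin_pi]
  obtain ⟨κ, hκ, hstep⟩ := H.exists_stepOp_ge
  have hb' : ∀ n, 0 ≤ b ^ n := fun n => by positivity
  have climb : ∀ K n, n ≤ K → κ ^ K ≤ (stepOp q c d)^[K] (fun n => b ^ n) n := by
    intro K
    induction K with
    | zero => intro n hn; simp [Nat.le_zero.1 hn]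
    | succ K ih =>
      intro n hn
      have hs := hstep _ (H.iterate_stepOp_nonneg hb' K)
      rw [Function.iterate_succ_apply', pow_succ']
      rcases n with _ | n
      · exact (mul_le_mul_of_nonneg_left (ih 0 (by omega)) hκ.le).trans (hs 0).1
      · exact (mul_le_mul_of_nonneg_left (ih n (by omega)) hκ.le).trans (hs n).2.2
  refine H.iterate_stepOp_zero_ge (w := w) hν hL ?_ ?_ ?_ hb' fun M =>
    ⟨M + L, κ ^ (M + L), by positivity, fun k => ?_⟩
  · have := hlt 1 one_pos hL1
    rw [hw_eq 0 (by omega)]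
    simpa using this
  · rw [hw_eq 0 (by omega), hw_eq 1 hL1]
    have := hadd 0
    simp only [Nat.cast_zero, Nat.cast_one, mul_zero, Real.sin_zero] at *
    norm_num at *
    linarith
  · intro k
    by_cases h : k + 2 ≤ L
    · rw [hw_eq k (by omega), hw_eq (k + 1) (by omega), hw_eq (k + 2) h]
      have := hadd (k + 1)
      push_cast
      rw [show (k : ℝ) + 1 + 2 = k + 2 + 1 by ring] at this
      linarith
    · have : w (k + 1) = 0 := if_neg (by omega)
      rw [this]
      linarith [hw_nonneg k, hw_nonneg (k + 2)]
  · by_cases h : k + 1 ≤ L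
    · refine le_trans ?_ (climb (M + L) (M + k) (by omega))
      rw [hw_eq k (by omega)]
      exact mul_le_of_le_one_right (by positivity) (Real.sin_le_one _)
    · have : w k = 0 := if_neg h
      rw [this, mul_zero]
      exact H.iterate_stepOp_nonneg hb' _ _

end Admissible

lemma tendsto_log_Zconst_of_le {q a b c d : ℝ} (H : Admissible q c d) (ha : 0 ≤ a) (hb : 0 ≤ b)
    (hab : a * b < 1) (hle : a ≤ b) :
    Filter.Tendsto (fun N : ℕ => (N : ℝ)⁻¹ * Real.log (Zconst N q a b c d))
      Filter.atTop (nhds (Real.log (max b 1 + 2 + (max b 1)⁻¹))) := by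
  have ha1 : a < 1 := by nlinarith
  have hs1 : 1 ≤ max b 1 := le_max_right _ _
  have has : a * max b 1 < 1 := by
    rcases max_choice b 1 with h | h <;> rw [h] <;> linarith
  have hbs : b ≤ max b 1 := le_max_left _ _
  have hlower : ∀ ν, 0 < ν → ν < max b 1 + 2 + (max b 1)⁻¹ → ∃ k > 0, ∃ N₀, ∀ N ≥ N₀,
      k * ν ^ N ≤ (stepOp q c d)^[N] (fun n => b ^ n) 0 := by
    intro ν hν hlt
    rcases le_or_gt b 1 with h | h
    · rw [max_eq_right h] at hlt
      exact H.iterate_stepOp_zero_ge_of_lt_four hb hν (by norm_num at hlt; exact hlt)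
    · rw [max_eq_left h.le] at hlt
      exact H.iterate_stepOp_zero_ge_of_one_lt h hν hlt
  generalize max b 1 = s at *
  have hs0 : 0 < s := by linarith
  have hsum := H.summable_revMeasure_mul_pow (mul_nonneg ha hs0.le) has
  set T : ℕ → ℕ → ℝ := fun N n =>
    a ^ n * (revMeasure q c d n * (stepOp q c d)^[N] (fun n => b ^ n) n) with hT
  have hT0 : ∀ N n, 0 ≤ T N n := by
    intro N n
    have := (H.revMeasure_pos n).le
    have := H.iterate_stepOp_nonneg (h := fun n => b ^ n) (fun n => by positivity) N n
    positivity
  have hTle : ∀ N n, T N n ≤ revMeasure q c d n * (a * s) ^ n * (s + 2 + s⁻¹) ^ N := by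
    intro N n
    have h1 := (H.revMeasure_pos n).le
    have h2 := H.iterate_stepOp_pow_le hb hbs hs1 N n
    calc T N n ≤ a ^ n * (revMeasure q c d n * ((s + 2 + s⁻¹) ^ N * s ^ n)) := by
          simp only [hT]; gcongr
      _ = _ := by rw [mul_pow]; ring
  have hTsum : ∀ N, Summable (T N) := fun N =>
    (hsum.mul_right _).of_nonneg_of_le (hT0 N) (hTle N)
  have hZ : ∀ N, Zconst N q a b c d = ∑' n, T N n := Zconst_eq_tsum H ha hb
  have h00 : revMeasure q c d 0 = 1 := by simp [revMeasure, qPoch]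
  refine tendsto_inv_mul_log (C := ∑' n, revMeasure q c d n * (a * s) ^ n) (by positivity)
    (hsum.tsum_pos (fun n => ?_) 0 (by simp [h00])) (fun N => ?_) fun ν hν hlt => ?_
  · have := (H.revMeasure_pos n).le
    positivity
  · rw [hZ, ← tsum_mul_right]
    exact (hTsum N).tsum_le_tsum (hTle N) (hsum.mul_right _)
  · obtain ⟨k, hk, N₀, hN₀⟩ := hlower ν hν hlt
    refine ⟨k, hk, N₀, fun N hN => (hN₀ N hN).trans ?_⟩
    rw [hZ]
    simpa [hT, h00] using (hTsum N).le_tsum 0 fun n _ => hT0 N n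

lemma neg_log_Jfun_of_le {a b : ℝ} (hb : 0 ≤ b) (hab : a * b < 1) (hle : a ≤ b) :
    -Real.log (Jfun a b) = Real.log (max b 1 + 2 + (max b 1)⁻¹) := by
  have ha : ¬ 1 < a := by intro h; nlinarith
  rw [Jfun, if_neg ha, ← Real.log_inv]
  congr 1
  split_ifs with h
  · have : 0 < b := by linarith
    rw [max_eq_left h.le]
    field_simp
    ring
  · rw [max_eq_right (not_lt.1 h)]
    norm_num

lemma Jfun_comm {a b : ℝ} (hab : a * b < 1) : Jfun a b = Jfun b a := by
  unfold Jfun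
  split_ifs with h1 h2
  · nlinarith
  all_goals rfl

/-- Lemma 2.5: exponential asymptotics of the normalization constant,
`lim (1/N) log Z_N = - log J(a,b)`. -/
theorem stmt8 (q a b c d : ℝ)
    (ha : 0 ≤ a) (hb : 0 ≤ b)
    (hc1 : -1 < c) (hc2 : c ≤ 0) (hd1 : -1 < d) (hd2 : d ≤ 0)
    (hq0 : 0 ≤ q) (hq1 : q < 1) (hab : a * b < 1) :
    Filter.Tendsto (fun N : ℕ => (N : ℝ)⁻¹ * Real.log (Zconst N q a b c d))
      Filter.atTop (nhds (-Real.log (Jfun a b))) := by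
  have H : Admissible q c d := ⟨hc1, hc2, hd1, hd2, hq0, hq1⟩
  rcases le_total a b with hle | hle
  · rw [neg_log_Jfun_of_le hb hab hle]
    exact tendsto_log_Zconst_of_le H ha hb hab hle
  · rw [mul_comm] at hab
    simp only [Zconst_comm H ha hb]
    rw [Jfun_comm (mul_comm b a ▸ hab), neg_log_Jfun_of_le ha hab hle]
    exact tendsto_log_Zconst_of_le H hb ha hab hle
end
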